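/- arXiv:2202.11894 — 3 statements merged into one kernel-verified Lean document; each statement's English description precedes it below -/
import Mathlib

section
/- Let (g,⟨·,·⟩) be a unimodular metric Lie algebra with dim g = 4 whose centre z satisfies dim z = 1, let Z ∈ z be nonzero, and let X ∈ g be a stationary point of the Euler equation. Then X is stable if and only if one of the following holds: (i) J_X = 0; (ii) σ₂(J_X) > 0; (iii) rank J_X = 1 and ⟨X,Z⟩ · Tr(J_X ∘ J_Z) < 0. -/
open scoped InnerProductSpace

/-- A Lie algebra structure (a bilinear Lie bracket) on the real inner product space `g`,
making `(g, ⟨·,·⟩)` a metric Lie algebra. -/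
structure LieStructure (g : Type*) [NormedAddCommGroup g] [InnerProductSpace ℝ g] where
  bracket : g →ₗ[ℝ] g →ₗ[ℝ] g
  bracket_self : ∀ x, bracket x x = 0
  jacobi : ∀ x y z, bracket x (bracket y z) + bracket y (bracket z x) + bracket z (bracket x y) = 0

namespace LieStructure

variable {g : Type*} [NormedAddCommGroup g] [InnerProductSpace ℝ g] [FiniteDimensional ℝ g]
variable (L : LieStructure g)

/-- `ad_Y : Z ↦ [Y, Z]`. -/
def ad (Y : g) : g →ₗ[ℝ] g := L.bracket Y

/-- `ad_Yᵗ`, the adjoint of `ad_Y` with respect to the inner product. -/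
noncomputable def adT (Y : g) : g →ₗ[ℝ] g := LinearMap.adjoint (L.ad Y)

/-- A solution of the Euler equation `Ẏ = ad_Yᵗ Y`. -/
def IsSolution (Y : ℝ → g) : Prop := ∀ t : ℝ, HasDerivAt Y (L.adT (Y t) (Y t)) t

/-- A stationary point (equilibrium) of the Euler equation: `ad_Xᵗ X = 0`. -/
def IsStationary (X : g) : Prop := L.adT X X = 0

/-- Lyapunov stability of a point `X` for the Euler equation: every solution starting
close to `X` remains close to `X` for all `t ≥ 0`. -/
def IsStable (X : g) : Prop :=
  ∀ ε > 0, ∃ δ > 0, ∀ Y : ℝ → g, L.IsSolution Y → ‖Y 0 - X‖ < δ → ∀ t ≥ 0, ‖Y t - X‖ < ε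

/-- The linearisation `J_X : Y ↦ ad_Xᵗ Y + ad_Yᵗ X` of the Euler equation at `X`. -/
noncomputable def J (X : g) : g →ₗ[ℝ] g where
  toFun Y := L.adT X Y + L.adT Y X
  map_add' Y Z := by
    simp only [adT, ad, map_add, LinearMap.add_apply]
    abel
  map_smul' c Y := by
    simp only [adT, ad, map_smul, map_smulₛₗ, starRingEnd_apply, star_trivial,
      LinearMap.smul_apply, RingHom.id_apply, smul_add]

/-- `g` is unimodular: `Tr (ad_X) = 0` for all `X`. -/
def IsUnimodular : Prop := ∀ X : g, LinearMap.trace ℝ g (L.ad X) = 0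

/-- The centre of `g`: the set of `X` with `[X, ·] = 0`. -/
def center : Submodule ℝ g := LinearMap.ker L.bracket

end LieStructure

/-- `σ_k(J)`: the `k`-th elementary symmetric function of the eigenvalues of `J`, i.e.
`(-1)^k` times the coefficient of `λ^(n-k)` in the characteristic polynomial
`det (λ·id - J)` of `J`, where `n = dim g`. -/
noncomputable def sigmaCoeff {g : Type*} [NormedAddCommGroup g] [InnerProductSpace ℝ g]
    [FiniteDimensional ℝ g] (k : ℕ) (J : g →ₗ[ℝ] g) : ℝ :=
  (-1 : ℝ) ^ k * (LinearMap.charpoly J).coeff (Module.finrank ℝ g - k)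

open Set Metric in
/-- A globally Lipschitz bounded vector field has global integral curves. -/
theorem exists_global_solution_of_lipschitz_of_bounded {E : Type*} [NormedAddCommGroup E]
    [NormedSpace ℝ E] [CompleteSpace E] {G : E → E} {K C : NNReal} (hK : LipschitzWith K G)
    (hC : ∀ x, ‖G x‖ ≤ C) (x : E) :
    ∃ α : ℝ → E, α 0 = x ∧ ∀ t, HasDerivAt α (G (α t)) t := by
  have loc : ∀ T : ℝ, 0 < T → ∃ α : ℝ → E, α 0 = x ∧
      ∀ t ∈ Ioo (-T) T, HasDerivAt α (G (α t)) t := by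
    intro T hT
    have hpl : IsPicardLindelof (fun _ => G) (tmin := -T) (tmax := T)
        ⟨0, by constructor <;> linarith⟩ x (C * T.toNNReal) 0 C K :=
      { lipschitzOnWith := fun _ _ => hK.lipschitzOnWith
        continuousOn := fun _ _ => continuousOn_const
        norm_le := fun _ _ y _ => hC y
        mul_max_le := by simp [hT.le] }
    obtain ⟨α, h0, h⟩ := hpl.exists_eq_forall_mem_Icc_hasDerivWithinAt₀
    exact ⟨α, h0, fun t ht =>
      (h t (Ioo_subset_Icc_self ht)).hasDerivAt (Icc_mem_nhds ht.1 ht.2)⟩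
  choose! α h0 hα using loc
  refine ⟨fun t => α (|t| + 1) t, h0 _ (by positivity), fun t => ?_⟩
  have hmem : t ∈ Ioo (-(|t| + 1)) (|t| + 1) := by
    constructor <;> linarith [neg_abs_le t, le_abs_self t]
  refine (hα (|t| + 1) (by positivity) t hmem).congr_of_eventuallyEq ?_
  filter_upwards [Ioo_mem_nhds hmem.1 hmem.2] with s hs
  have key : ∀ a b : ℝ, 0 < a → a ≤ b → EqOn (α a) (α b) (Ioo (-a) a) := by
    intro a b ha hab
    exact ODE_solution_unique_of_mem_Ioo (v := fun _ => G) (s := fun _ => univ) (t₀ := 0)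
      (fun _ _ => hK.lipschitzOnWith) ⟨by linarith, ha⟩
      (fun t ht => ⟨hα a ha t ht, mem_univ _⟩)
      (fun t ht => ⟨hα b (by linarith) t ⟨by linarith [ht.1], by linarith [ht.2]⟩, mem_univ _⟩)
      (by rw [h0 a ha, h0 b (by linarith)])
  have hs' : s ∈ Ioo (-(|s| + 1)) (|s| + 1) := by
    constructor <;> linarith [neg_abs_le s, le_abs_self s]
  rcases le_total |s| |t| with h | h
  · exact key _ _ (by positivity) (by linarith) hs'
  · exact (key _ _ (by positivity) (by linarith) hs).symm

namespace LieStructure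

variable {g : Type*} [NormedAddCommGroup g] [InnerProductSpace ℝ g] [FiniteDimensional ℝ g]
variable (L : LieStructure g)

theorem inner_adT (W Y U : g) : ⟪U, L.adT Y W⟫_ℝ = ⟪W, L.bracket Y U⟫_ℝ := by
  rw [adT, LinearMap.adjoint_inner_right, real_inner_comm, ad]

theorem contDiff_eulerField : ContDiff ℝ 1 fun Y : g => L.adT Y Y := by
  let B : g →ₗ[ℝ] g →ₗ[ℝ] g :=
    { toFun := L.adT
      map_add' := fun x y => by simp [adT, ad]
      map_smul' := fun c x => by simp [adT, ad] }
  have hB : (fun Y : g => L.adT Y Y) = fun Y => B.toContinuousBilinearMap Y Y := rfl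
  rw [hB]
  exact B.toContinuousBilinearMap.contDiff.clm_apply contDiff_id

/-- The Euler equation has global solutions, because it conserves the norm. -/
theorem exists_isSolution (Y₀ : g) : ∃ Y : ℝ → g, Y 0 = Y₀ ∧ L.IsSolution Y := by
  have : CompleteSpace g := FiniteDimensional.complete ℝ g
  let φ : ContDiffBump (0 : g) := ⟨‖Y₀‖ + 1, ‖Y₀‖ + 2, by positivity, by linarith⟩
  have hG : ContDiff ℝ 1 fun Y : g => φ Y • L.adT Y Y :=
    φ.contDiff.smul L.contDiff_eulerField
  have hs : HasCompactSupport fun Y : g => φ Y • L.adT Y Y := φ.hasCompactSupport.smul_right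
  obtain ⟨K, hK⟩ := hG.lipschitzWith_of_hasCompactSupport hs (by simp)
  obtain ⟨C, hC⟩ := hs.exists_bound_of_continuous hG.continuous
  obtain ⟨Y, h0, hY⟩ := exists_global_solution_of_lipschitz_of_bounded hK (C := C.toNNReal)
    (fun x => (hC x).trans (Real.le_coe_toNNReal C)) Y₀
  refine ⟨Y, h0, fun t => ?_⟩
  have hd : ∀ t, HasDerivAt (fun t => ⟪Y t, Y t⟫_ℝ) 0 t := by
    intro t
    have h := (hY t).inner ℝ (hY t)
    have h2 : ⟪Y t, L.adT (Y t) (Y t)⟫_ℝ = 0 := by rw [inner_adT, L.bracket_self]; simp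
    have h3 : ⟪L.adT (Y t) (Y t), Y t⟫_ℝ = 0 := by rw [real_inner_comm, h2]
    simpa [inner_smul_left, inner_smul_right, h2, h3] using h
  have hc : ⟪Y t, Y t⟫_ℝ = ⟪Y 0, Y 0⟫_ℝ :=
    is_const_of_deriv_eq_zero (fun t => (hd t).differentiableAt) (fun t => (hd t).deriv) t 0
  have hn : ‖Y t‖ = ‖Y₀‖ := by
    rw [real_inner_self_eq_norm_sq, real_inner_self_eq_norm_sq, h0] at hc
    exact (sq_eq_sq₀ (norm_nonneg _) (norm_nonneg _)).1 hc
  have h1 : φ (Y t) = 1 := φ.one_of_mem_closedBall (by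
    change Y t ∈ Metric.closedBall 0 (‖Y₀‖ + 1)
    simp [hn])
  simpa [h1] using hY t

/-- A stationary point which is an isolated zero of a nonnegative first integral is stable. -/
theorem isStable_of_firstIntegral {X : g} {V : g → ℝ} (hV : Continuous V)
    (hcons : ∀ Y, L.IsSolution Y → ∀ t, V (Y t) = V (Y 0)) (hX : V X = 0) {ρ : ℝ} (hρ : 0 < ρ)
    (hpos : ∀ Y, Y ≠ X → ‖Y - X‖ < ρ → 0 < V Y) : L.IsStable X := by
  have : ProperSpace g := FiniteDimensional.proper ℝ g
  intro ε hε
  set σ := min ε (ρ / 2) with hσ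
  have hσ0 : 0 < σ := by positivity
  obtain ⟨m, hm0, hm⟩ : ∃ m > 0, ∀ Y ∈ Metric.sphere X σ, m ≤ V Y := by
    rcases (Metric.sphere X σ).eq_empty_or_nonempty with h | h
    · exact ⟨1, one_pos, by simp [h]⟩
    · obtain ⟨Y, hY, hmin⟩ := (isCompact_sphere X σ).exists_isMinOn h hV.continuousOn
      refine ⟨V Y, hpos Y ?_ ?_, fun W hW => hmin hW⟩
      · rintro rfl
        simp at hY
        linarith
      · rw [mem_sphere_iff_norm] at hY
        rw [hY]
        linarith [min_le_right ε (ρ / 2)]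
  obtain ⟨δ, hδ, hδV⟩ := Metric.continuous_iff.1 hV X m hm0
  refine ⟨min δ σ, by positivity, fun Y hY h0 t ht => ?_⟩
  by_contra! hcon
  have hcont : ContinuousOn (fun s => ‖Y s - X‖) (Set.Icc 0 t) :=
    fun s _ => ((hY s).continuousAt.sub continuousAt_const).norm.continuousWithinAt
  obtain ⟨s, -, hs⟩ := intermediate_value_Icc ht hcont
    (show σ ∈ _ from ⟨(h0.trans_le (min_le_right _ _)).le, (min_le_left _ _).trans hcon⟩)
  have h1 := hm (Y s) (mem_sphere_iff_norm.2 hs)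
  have h2 := hδV (Y 0) (by rw [dist_eq_norm]; exact h0.trans_le (min_le_left _ _))
  rw [hX, Real.dist_eq, sub_zero] at h2
  rw [hcons Y hY s] at h1
  linarith [le_abs_self (V (Y 0))]

end LieStructure

/-- A function whose derivative is bounded below by a positive constant is unbounded. -/
theorem not_bounded_of_deriv_ge {f f' : ℝ → ℝ} {c M : ℝ} (hc : 0 < c)
    (hf : ∀ s, HasDerivAt f (f' s) s) (hf' : ∀ s ≥ 0, c ≤ f' s) (hM : ∀ s ≥ 0, |f s| ≤ M) :
    False := by
  have key : ∀ s ≥ 0, c * (s - 0) ≤ f s - f 0 := fun s hs =>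
    (convex_Ici (0 : ℝ)).mul_sub_le_image_sub_of_le_deriv
      (fun x _ => (hf x).continuousAt.continuousWithinAt)
      (fun x _ => (hf x).differentiableAt.differentiableWithinAt)
      (fun x hx => by rw [(hf x).deriv]; exact hf' x (interior_subset hx))
      0 (by simp) s hs hs
  have hM0 : 0 ≤ M := (abs_nonneg _).trans (hM 0 le_rfl)
  have h := key ((2 * M + 1) / c) (by positivity)
  rw [sub_zero, mul_div_cancel₀ _ hc.ne'] at h
  linarith [abs_le.1 (hM ((2 * M + 1) / c) (by positivity)), abs_le.1 (hM 0 le_rfl)]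

theorem eq_initial_of_hasDerivAt_zero {f f' : ℝ → ℝ} (hf : ∀ s, HasDerivAt f (f' s) s)
    (hf' : ∀ s, f' s = 0) (s : ℝ) : f s = f 0 :=
  is_const_of_deriv_eq_zero (fun s => (hf s).differentiableAt)
    (fun s => by rw [(hf s).deriv, hf' s]) s 0

theorem abs_mul_le_mul {a b A B : ℝ} (ha : |a| ≤ A) (hb : |b| ≤ B) : |a * b| ≤ A * B :=
  abs_mul a b ▸ mul_le_mul ha hb (abs_nonneg _) ((abs_nonneg _).trans ha)

theorem exists_entry_bound (m₁ m₂ p₁ p₂ q : ℝ) :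
    ∃ K > 0, |m₁| ≤ K ∧ |m₂| ≤ K ∧ |p₁| ≤ K ∧ |p₂| ≤ K ∧ |q| ≤ K := by
  refine ⟨|m₁| + |m₂| + |p₁| + |p₂| + |q| + 1, by positivity, ?_, ?_, ?_, ?_, ?_⟩ <;>
    linarith [abs_nonneg m₁, abs_nonneg m₂, abs_nonneg p₁, abs_nonneg p₂, abs_nonneg q]

/-- Parameters of a gyrostat near a permanent rotation `r e₃` with `e₁, e₂` diagonalising
the transversal part of the quadratic energy `B = [[m₁, 0, p₁], [0, m₂, p₂], [p₁, p₂, q]]`;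
`b` is the gyrostatic vector. -/
structure GyrostatParams where
  (m₁ m₂ p₁ p₂ q b₁ b₂ b₃ r : ℝ)

namespace GyrostatParams

variable (P : GyrostatParams)

/-- The deviation `v` from `r e₃` solves `v' = (B v + t b) × (r e₃ + v)`. -/
structure IsOrbit (t : ℝ) (v₁ v₂ v₃ : ℝ → ℝ) : Prop where
  deriv₁ : ∀ s, HasDerivAt v₁ ((P.m₂ * v₂ s + P.p₂ * v₃ s + t * P.b₂) * (P.r + v₃ s) -
    (P.p₁ * v₁ s + P.p₂ * v₂ s + P.q * v₃ s + t * P.b₃) * v₂ s) s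
  deriv₂ : ∀ s, HasDerivAt v₂ ((P.p₁ * v₁ s + P.p₂ * v₂ s + P.q * v₃ s + t * P.b₃) * v₁ s -
    (P.m₁ * v₁ s + P.p₁ * v₃ s + t * P.b₁) * (P.r + v₃ s)) s
  deriv₃ : ∀ s, HasDerivAt v₃ ((P.m₁ * v₁ s + P.p₁ * v₃ s + t * P.b₁) * v₂ s -
    (P.m₂ * v₂ s + P.p₂ * v₃ s + t * P.b₂) * v₁ s) s

/-- All initial deviations and parameters `t` close to zero have an orbit staying close to
zero in forward time. -/
def HasStableOrbits : Prop :=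
  ∀ ε > 0, ∃ δ > 0, ∀ η₁ η₂ η₃ t : ℝ, |η₁| < δ → |η₂| < δ → |η₃| < δ → |t| < δ →
    ∃ v₁ v₂ v₃ : ℝ → ℝ, P.IsOrbit t v₁ v₂ v₃ ∧ v₁ 0 = η₁ ∧ v₂ 0 = η₂ ∧ v₃ 0 = η₃ ∧
      ∀ s ≥ 0, |v₁ s| ≤ ε ∧ |v₂ s| ≤ ε ∧ |v₃ s| ≤ ε

/-- The parameters in the frame `(e₂, -e₁, e₃)`. -/
def swap : GyrostatParams :=
  ⟨P.m₂, P.m₁, P.p₂, -P.p₁, P.q, P.b₂, -P.b₁, P.b₃, P.r⟩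

variable {P}

theorem HasStableOrbits.swap (h : P.HasStableOrbits) : P.swap.HasStableOrbits := by
  intro ε hε
  obtain ⟨δ, hδ, H⟩ := h ε hε
  refine ⟨δ, hδ, fun η₁ η₂ η₃ t h₁ h₂ h₃ ht => ?_⟩
  obtain ⟨v₁, v₂, v₃, ho, i₁, i₂, i₃, hv⟩ := H (-η₂) η₁ η₃ t (by rwa [abs_neg]) h₁ h₃ ht
  refine ⟨v₂, fun s => -v₁ s, v₃, ⟨fun s => ?_, fun s => ?_, fun s => ?_⟩, i₂, by simp [i₁], i₃,
    fun s hs => ⟨(hv s hs).2.1, by rw [abs_neg]; exact (hv s hs).1, (hv s hs).2.2⟩⟩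
  · exact (ho.deriv₂ s).congr_deriv (by simp only [GyrostatParams.swap]; ring)
  · exact (ho.deriv₁ s).neg.congr_deriv (by simp only [GyrostatParams.swap]; ring)
  · exact (ho.deriv₃ s).congr_deriv (by simp only [GyrostatParams.swap]; ring)

namespace IsOrbit

variable {t : ℝ} {v₁ v₂ v₃ : ℝ → ℝ}

theorem momentum_eq (h : P.IsOrbit t v₁ v₂ v₃) (s : ℝ) :
    2 * P.r * v₃ s + v₁ s ^ 2 + v₂ s ^ 2 + v₃ s ^ 2 =
      2 * P.r * v₃ 0 + v₁ 0 ^ 2 + v₂ 0 ^ 2 + v₃ 0 ^ 2 :=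
  eq_initial_of_hasDerivAt_zero
    (fun s => ((((h.deriv₃ s).const_mul (2 * P.r)).add ((h.deriv₁ s).pow 2)).add
      ((h.deriv₂ s).pow 2)).add ((h.deriv₃ s).pow 2))
    (fun s => by push_cast; ring) s

theorem energy_eq (h : P.IsOrbit t v₁ v₂ v₃) (s : ℝ) :
    P.m₁ * v₁ s ^ 2 + P.m₂ * v₂ s ^ 2 + P.q * v₃ s ^ 2 +
        2 * (P.p₁ * (v₁ s * v₃ s)) + 2 * (P.p₂ * (v₂ s * v₃ s)) +
        2 * t * (P.b₁ * v₁ s + P.b₂ * v₂ s + P.b₃ * v₃ s) =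
      P.m₁ * v₁ 0 ^ 2 + P.m₂ * v₂ 0 ^ 2 + P.q * v₃ 0 ^ 2 +
        2 * (P.p₁ * (v₁ 0 * v₃ 0)) + 2 * (P.p₂ * (v₂ 0 * v₃ 0)) +
        2 * t * (P.b₁ * v₁ 0 + P.b₂ * v₂ 0 + P.b₃ * v₃ 0) :=
  eq_initial_of_hasDerivAt_zero
    (fun s => (((((((h.deriv₁ s).pow 2).const_mul P.m₁).add
      (((h.deriv₂ s).pow 2).const_mul P.m₂)).add (((h.deriv₃ s).pow 2).const_mul P.q)).add
      ((((h.deriv₁ s).mul (h.deriv₃ s)).const_mul P.p₁).const_mul 2)).add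
      ((((h.deriv₂ s).mul (h.deriv₃ s)).const_mul P.p₂).const_mul 2)).add
      (((((h.deriv₁ s).const_mul P.b₁).add ((h.deriv₂ s).const_mul P.b₂)).add
        ((h.deriv₃ s).const_mul P.b₃)).const_mul (2 * t)))
    (fun s => by push_cast; ring) s

end IsOrbit

theorem saddle_inequality {m₁ m₂ p₁ p₂ q r v₁ v₂ v₃ ε κ K : ℝ} (hr : 0 < r)
    (h₁ : |v₁| ≤ ε) (h₂ : |v₂| ≤ ε) (h₃ : |v₃| ≤ ε) (hεr : ε ≤ r) (hm₁ : κ ≤ -m₁) (hm₂ : κ ≤ m₂)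
    (km₁ : |m₁| ≤ K) (km₂ : |m₂| ≤ K) (kp₁ : |p₁| ≤ K) (kp₂ : |p₂| ≤ K) (kq : |q| ≤ K)
    (hs : 2 * r * v₃ + v₁ ^ 2 + v₂ ^ 2 + v₃ ^ 2 = 0) (hε : 16 * (K * ε) ≤ r * κ) :
    r * κ / 2 * (v₁ ^ 2 + v₂ ^ 2) ≤
      ((m₂ * v₂ + p₂ * v₃) * (r + v₃) - (p₁ * v₁ + p₂ * v₂ + q * v₃) * v₂) * v₂ +
      v₁ * ((p₁ * v₁ + p₂ * v₂ + q * v₃) * v₁ - (m₁ * v₁ + p₁ * v₃) * (r + v₃)) := by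
  have hε0 : 0 ≤ ε := (abs_nonneg _).trans h₁
  have hK0 : 0 ≤ K := (abs_nonneg _).trans km₁
  obtain ⟨N, hN⟩ : ∃ N, N = v₁ ^ 2 + v₂ ^ 2 := ⟨_, rfl⟩
  have hN0 : 0 ≤ N := by rw [hN]; positivity
  have hv₃ : v₃ ≤ 0 := by nlinarith [sq_nonneg v₁, sq_nonneg v₂, sq_nonneg v₃]
  rw [abs_of_nonpos hv₃] at h₃
  have hu : r * -v₃ ≤ N := by nlinarith
  have hsq : v₃ ^ 2 ≤ N := by nlinarith
  have hp : |p₂ * v₂ - p₁ * v₁| ≤ 2 * (K * ε) := by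
    have := abs_sub (p₂ * v₂) (p₁ * v₁)
    linarith [abs_mul_le_mul kp₁ h₁, abs_mul_le_mul kp₂ h₂]
  have t₁ : |r * v₃ * (p₂ * v₂ - p₁ * v₁)| ≤ N * (2 * (K * ε)) :=
    abs_mul_le_mul (by rw [abs_of_nonpos (by nlinarith)]; linarith) hp
  have t₂ : |v₃ ^ 2 * (p₂ * v₂ - p₁ * v₁)| ≤ N * (2 * (K * ε)) :=
    abs_mul_le_mul (by rwa [abs_of_nonneg (sq_nonneg _)]) hp
  have t₃ : |v₃ * (m₂ * v₂ ^ 2 - m₁ * v₁ ^ 2)| ≤ ε * (K * N) := by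
    refine abs_mul_le_mul (by rwa [abs_of_nonpos hv₃]) ?_
    have := abs_sub (m₂ * v₂ ^ 2) (m₁ * v₁ ^ 2)
    have a₁ : |m₁ * v₁ ^ 2| ≤ K * v₁ ^ 2 :=
      abs_mul_le_mul km₁ (abs_of_nonneg (sq_nonneg _)).le
    have a₂ : |m₂ * v₂ ^ 2| ≤ K * v₂ ^ 2 :=
      abs_mul_le_mul km₂ (abs_of_nonneg (sq_nonneg _)).le
    rw [hN]
    linarith
  have t₄ : |(p₁ * v₁ + p₂ * v₂ + q * v₃) * (v₁ ^ 2 - v₂ ^ 2)| ≤ (3 * (K * ε)) * N := by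
    refine abs_mul_le_mul ?_ ?_
    · have := abs_add_three (p₁ * v₁) (p₂ * v₂) (q * v₃)
      linarith [abs_mul_le_mul kp₁ h₁, abs_mul_le_mul kp₂ h₂,
        abs_mul_le_mul kq (show |v₃| ≤ ε by rwa [abs_of_nonpos hv₃])]
    · rw [abs_le]
      constructor <;> nlinarith [sq_nonneg v₁, sq_nonneg v₂]
  have t₅ : r * κ * N ≤ r * (m₂ * v₂ ^ 2 - m₁ * v₁ ^ 2) := by
    rw [hN, mul_assoc]
    exact mul_le_mul_of_nonneg_left (by nlinarith [sq_nonneg v₁, sq_nonneg v₂]) hr.le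
  have t₆ : 16 * (K * ε) * N ≤ r * κ * N := mul_le_mul_of_nonneg_right hε hN0
  have e : ((m₂ * v₂ + p₂ * v₃) * (r + v₃) - (p₁ * v₁ + p₂ * v₂ + q * v₃) * v₂) * v₂ +
      v₁ * ((p₁ * v₁ + p₂ * v₂ + q * v₃) * v₁ - (m₁ * v₁ + p₁ * v₃) * (r + v₃)) =
      r * (m₂ * v₂ ^ 2 - m₁ * v₁ ^ 2) + r * v₃ * (p₂ * v₂ - p₁ * v₁) +
      v₃ ^ 2 * (p₂ * v₂ - p₁ * v₁) + v₃ * (m₂ * v₂ ^ 2 - m₁ * v₁ ^ 2) +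
      (p₁ * v₁ + p₂ * v₂ + q * v₃) * (v₁ ^ 2 - v₂ ^ 2) := by ring
  rw [e, ← hN]
  linarith [(abs_le.1 t₁).1, (abs_le.1 t₂).1, (abs_le.1 t₃).1, (abs_le.1 t₄).1]

theorem not_hasStableOrbits_of_saddle (hr : 0 < P.r) (hm₁ : P.m₁ < 0) (hm₂ : 0 < P.m₂) :
    ¬ P.HasStableOrbits := by
  intro hst
  obtain ⟨m₁, m₂, p₁, p₂, q, b₁, b₂, b₃, r⟩ := P
  simp only at hr hm₁ hm₂
  obtain ⟨K, hK0, km₁, km₂, kp₁, kp₂, kq⟩ := exists_entry_bound m₁ m₂ p₁ p₂ q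
  set κ := min (-m₁) m₂ with hκ
  have hκ0 : 0 < κ := lt_min (by linarith) hm₂
  set ε := min r (r * κ / (16 * K)) with hε
  have hε0 : 0 < ε := by positivity
  have hεK : 16 * (K * ε) ≤ r * κ := by
    have := (le_div_iff₀ (by positivity)).1 (min_le_right r (r * κ / (16 * K)))
    linarith
  obtain ⟨δ, hδ, H⟩ := hst ε hε0
  obtain ⟨a, ha0, ha1, ha⟩ : ∃ a : ℝ, 0 < a ∧ a < 1 ∧ 4 * a * r < δ := by
    refine ⟨min (1 / 2) (δ / (8 * r)), by positivity,
      (min_le_left _ _).trans_lt (by norm_num), ?_⟩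
    have := (le_div_iff₀ (by positivity)).1 (min_le_right (1 / 2) (δ / (8 * r)))
    linarith
  have hD : 0 < 1 + 2 * a ^ 2 := by positivity
  have hη : |2 * a * r / (1 + 2 * a ^ 2)| < δ := by
    rw [abs_of_nonneg (by positivity)]
    refine (div_le_self (by positivity) (by nlinarith)).trans_lt (by nlinarith)
  have hη₃ : |-(4 * a ^ 2 * r / (1 + 2 * a ^ 2))| < δ := by
    rw [abs_neg, abs_of_nonneg (by positivity)]
    refine (div_le_self (by positivity) (by nlinarith)).trans_lt ?_
    nlinarith [mul_pos ha0 hr]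
  obtain ⟨v₁, v₂, v₃, ho, i₁, i₂, i₃, hv⟩ :=
    H (2 * a * r / (1 + 2 * a ^ 2)) (2 * a * r / (1 + 2 * a ^ 2))
      (-(4 * a ^ 2 * r / (1 + 2 * a ^ 2))) 0 hη hη hη₃ (by simpa using hδ)
  have hmom : ∀ s, 2 * r * v₃ s + v₁ s ^ 2 + v₂ s ^ 2 + v₃ s ^ 2 = 0 := by
    intro s
    have := ho.momentum_eq s
    rw [i₁, i₂, i₃] at this
    simp only at this
    rw [this]
    field_simp
    ring
  have hV := fun s => (ho.deriv₁ s).mul (ho.deriv₂ s)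
  simp only [zero_mul, add_zero] at hV
  have hle := fun (s : ℝ) (hs : s ≥ 0) => saddle_inequality hr (hv s hs).1 (hv s hs).2.1
    (hv s hs).2.2 (min_le_left _ _) (min_le_left (-m₁) m₂) (min_le_right (-m₁) m₂)
    km₁ km₂ kp₁ kp₂ kq
    (hmom s) hεK
  have hmono : ∀ s ≥ 0, v₁ 0 * v₂ 0 ≤ v₁ s * v₂ s := by
    intro s hs
    have hm : MonotoneOn (v₁ * v₂) (Set.Ici 0) :=
      monotoneOn_of_deriv_nonneg (convex_Ici 0)
        (fun x _ => (hV x).continuousAt.continuousWithinAt)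
        (fun x _ => (hV x).differentiableAt.differentiableWithinAt)
        (fun x hx => by
          rw [(hV x).deriv]
          exact le_trans (by positivity) (hle x (interior_subset hx)))
    exact hm (by simp) hs hs
  have hinit : 0 < v₁ 0 * v₂ 0 := by rw [i₁, i₂]; positivity
  refine not_bounded_of_deriv_ge (c := r * κ / 2 * (2 * (v₁ 0 * v₂ 0))) (M := ε * ε)
    (by positivity) hV (fun s hs => le_trans ?_ (hle s hs))
    (fun s hs => abs_mul_le_mul (hv s hs).1 (hv s hs).2.1)
  refine mul_le_mul_of_nonneg_left ?_ (by positivity)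
  linarith [hmono s hs, sq_nonneg (v₁ s - v₂ s)]

end GyrostatParams

namespace GyrostatParams

variable {P : GyrostatParams}

theorem parabolic_bounds {r v₁ v₂ v₃ ε g : ℝ} (hr : 0 < r) (h₃ : |v₃| ≤ ε) (hεr : ε ≤ r)
    (hg : 0 < g) (hs : 2 * r * v₃ + v₁ ^ 2 + v₂ ^ 2 + v₃ ^ 2 = -g) :
    |r * v₃| ≤ g + v₁ ^ 2 + v₂ ^ 2 ∧ r * v₃ ^ 2 ≤ ε * (g + v₁ ^ 2 + v₂ ^ 2) := by
  have hv₃ : v₃ ≤ 0 := by nlinarith [sq_nonneg v₁, sq_nonneg v₂, sq_nonneg v₃]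
  rw [abs_of_nonpos hv₃] at h₃
  have hu : r * -v₃ ≤ g + v₁ ^ 2 + v₂ ^ 2 := by nlinarith
  refine ⟨by rw [abs_of_nonpos (by nlinarith)]; linarith, ?_⟩
  have : r * v₃ ^ 2 = -v₃ * (r * -v₃) := by ring
  rw [this]
  exact mul_le_mul h₃ hu (by nlinarith) (by linarith)

theorem degenerate_inequality {m p₁ p₂ q r v₁ v₂ v₃ ε g η K : ℝ} (hr : 0 < r) (hm : m ≠ 0)
    (h₁ : |v₁| ≤ ε) (h₂ : |v₂| ≤ ε) (h₃ : |v₃| ≤ ε) (hεr : ε ≤ r) (hg : 0 < g)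
    (hη : r * η ^ 2 ≤ ε * g)
    (km : |m| ≤ K) (kp₁ : |p₁| ≤ K) (kp₂ : |p₂| ≤ K) (kq : |q| ≤ K)
    (hs : 2 * r * v₃ + v₁ ^ 2 + v₂ ^ 2 + v₃ ^ 2 = -g)
    (he : m * v₁ ^ 2 + q * v₃ ^ 2 + 2 * (p₁ * (v₁ * v₃)) + 2 * (p₂ * (v₂ * v₃)) = q * η ^ 2)
    (hε : 12 * (K ^ 3 * ε) ≤ r * |m| * p₂ ^ 2) :
    p₂ ^ 2 / 4 * g ≤ -p₂ * (p₂ * v₃ * (r + v₃) - (p₁ * v₁ + p₂ * v₂ + q * v₃) * v₂) := by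
  have hε0 : 0 ≤ ε := (abs_nonneg _).trans h₁
  have hK0 : 0 ≤ K := (abs_nonneg _).trans km
  obtain ⟨hrv, hrv2⟩ := parabolic_bounds hr h₃ hεr hg hs
  obtain ⟨G, hG⟩ : ∃ G, G = g + v₁ ^ 2 + v₂ ^ 2 := ⟨_, rfl⟩
  rw [← hG] at hrv hrv2
  have hgG : g ≤ G := by rw [hG]; nlinarith [sq_nonneg v₁, sq_nonneg v₂]
  have hG0 : 0 < G := hg.trans_le hgG
  have hμ : 0 < r * |m| := mul_pos hr (abs_pos.2 hm)
  have hv₁ : r * |m| * v₁ ^ 2 ≤ 6 * (K * ε * G) := by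
    have e₁ : |q * (r * η ^ 2)| ≤ K * (ε * G) := by
      refine abs_mul_le_mul kq ?_
      rw [abs_of_nonneg (by positivity)]
      exact hη.trans (mul_le_mul_of_nonneg_left hgG hε0)
    have e₂ : |q * (r * v₃ ^ 2)| ≤ K * (ε * G) :=
      abs_mul_le_mul kq (by rwa [abs_of_nonneg (by positivity)])
    have e₃ : |r * v₃ * (p₁ * v₁)| ≤ G * (K * ε) := abs_mul_le_mul hrv (abs_mul_le_mul kp₁ h₁)
    have e₄ : |r * v₃ * (p₂ * v₂)| ≤ G * (K * ε) := abs_mul_le_mul hrv (abs_mul_le_mul kp₂ h₂)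
    have e : |r * (m * v₁ ^ 2)| = r * |m| * v₁ ^ 2 := by
      rw [abs_mul, abs_mul, abs_of_pos hr, abs_of_nonneg (sq_nonneg v₁)]
      ring
    have e' : r * (m * v₁ ^ 2) = q * (r * η ^ 2) - q * (r * v₃ ^ 2) - 2 * (r * v₃ * (p₁ * v₁)) -
        2 * (r * v₃ * (p₂ * v₂)) := by linear_combination r * he
    rw [← e, e', abs_le]
    rw [abs_le] at e₁ e₂ e₃ e₄
    constructor <;> linarith
  have t₁ : |m| * (p₂ ^ 2 * (r * v₃ ^ 2)) ≤ K * (K ^ 2 * (ε * G)) := by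
    have : p₂ ^ 2 ≤ K ^ 2 := sq_le_sq' (abs_le.1 kp₂).1 (abs_le.1 kp₂).2
    gcongr
  have t₂ : p₁ ^ 2 * (r * |m| * v₁ ^ 2) ≤ K ^ 2 * (6 * (K * ε * G)) := by
    have : p₁ ^ 2 ≤ K ^ 2 := sq_le_sq' (abs_le.1 kp₁).1 (abs_le.1 kp₁).2
    gcongr
  have t₃ : |(|m|) * (p₂ * (q * (r * v₃ * v₂)))| ≤ K * (K * (K * (G * ε))) :=
    abs_mul_le_mul (by rwa [abs_abs])
      (abs_mul_le_mul kp₂ (abs_mul_le_mul kq (abs_mul_le_mul hrv h₂)))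
  have t₄ : 0 ≤ r * |m| * (p₁ * v₁ + 2 * (p₂ * v₂)) ^ 2 := by positivity
  have t₅ : 12 * (K ^ 3 * ε) * G ≤ r * |m| * p₂ ^ 2 * G :=
    mul_le_mul_of_nonneg_right hε hG0.le
  have hrv₃ : r * v₃ = -(G + v₃ ^ 2) / 2 := by rw [hG]; linarith
  have key : r * |m| * (p₂ ^ 2 / 4 * G) ≤
      r * |m| * (-p₂ * (p₂ * v₃ * (r + v₃) - (p₁ * v₁ + p₂ * v₂ + q * v₃) * v₂)) := by
    have e : -p₂ * (p₂ * v₃ * (r + v₃) - (p₁ * v₁ + p₂ * v₂ + q * v₃) * v₂) =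
        p₂ ^ 2 * G / 2 - p₂ ^ 2 * v₃ ^ 2 / 2 + p₂ * (p₁ * v₁ + p₂ * v₂ + q * v₃) * v₂ := by
      linear_combination -p₂ ^ 2 * hrv₃
    rw [e]
    linarith [(abs_le.1 t₃).1]
  exact (mul_le_mul_of_nonneg_left hgG (by positivity)).trans (le_of_mul_le_mul_left key hμ)

theorem not_hasStableOrbits_of_degenerate (hr : 0 < P.r) (hm₁ : P.m₁ ≠ 0) (hm₂ : P.m₂ = 0)
    (hp₂ : P.p₂ ≠ 0) : ¬ P.HasStableOrbits := by
  intro hst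
  obtain ⟨m, m₂, p₁, p₂, q, b₁, b₂, b₃, r⟩ := P
  simp only at hr hm₁ hm₂ hp₂
  subst hm₂
  obtain ⟨K, hK0, km, -, kp₁, kp₂, kq⟩ := exists_entry_bound m 0 p₁ p₂ q
  set ε := min r (r * |m| * p₂ ^ 2 / (12 * K ^ 3)) with hε
  have hm0 := abs_pos.2 hm₁
  have hε0 : 0 < ε := by positivity
  have hεr : ε ≤ r := min_le_left _ _
  have hεK : 12 * (K ^ 3 * ε) ≤ r * |m| * p₂ ^ 2 := by
    have := (le_div_iff₀ (by positivity)).1 (min_le_right r (r * |m| * p₂ ^ 2 / (12 * K ^ 3)))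
    linarith
  obtain ⟨δ, hδ, H⟩ := hst ε hε0
  obtain ⟨η, hη0, hηδ, hηε⟩ : ∃ η : ℝ, 0 < η ∧ η < δ ∧ η < ε := by
    obtain ⟨η, h0, h⟩ := exists_between (lt_min hδ hε0)
    exact ⟨η, h0, h.trans_le (min_le_left _ _), h.trans_le (min_le_right _ _)⟩
  obtain ⟨v₁, v₂, v₃, ho, i₁, i₂, i₃, hv⟩ := H 0 0 (-η) 0 (by simpa using hδ) (by simpa using hδ)
    (by rwa [abs_neg, abs_of_pos hη0]) (by simpa using hδ)
  have hmom : ∀ s, 2 * r * v₃ s + v₁ s ^ 2 + v₂ s ^ 2 + v₃ s ^ 2 = -(η * (2 * r - η)) := by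
    intro s
    have := ho.momentum_eq s
    rw [i₁, i₂, i₃] at this
    linear_combination this
  have hen : ∀ s, m * v₁ s ^ 2 + q * v₃ s ^ 2 + 2 * (p₁ * (v₁ s * v₃ s)) +
      2 * (p₂ * (v₂ s * v₃ s)) = q * η ^ 2 := by
    intro s
    have := ho.energy_eq s
    rw [i₁, i₂, i₃] at this
    linear_combination this
  have hg : 0 < η * (2 * r - η) := mul_pos hη0 (by linarith)
  refine not_bounded_of_deriv_ge (f := fun s => -p₂ * v₁ s) (M := |-p₂| * ε)
    (c := p₂ ^ 2 / 4 * (η * (2 * r - η))) (by positivity)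
    (fun s => (ho.deriv₁ s).const_mul (-p₂)) (fun s hs => ?_)
    (fun s hs => abs_mul_le_mul le_rfl (hv s hs).1)
  have := degenerate_inequality hr hm₁ (hv s hs).1 (hv s hs).2.1 (hv s hs).2.2 hεr hg
    (by nlinarith [mul_pos hη0 hr, mul_nonneg hη0.le (mul_nonneg hε0.le (sub_nonneg.2 (hηε.le.trans hεr))),
      mul_nonneg (mul_nonneg hη0.le hr.le) (sub_nonneg.2 hηε.le)])
    km kp₁ kp₂ kq (hmom s) (hen s) hεK
  simpa using this

theorem isotropic_inequality {p₁ p₂ q r v₁ v₂ v₃ ε g K : ℝ} (hr : 0 < r)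
    (h₁ : |v₁| ≤ ε) (h₂ : |v₂| ≤ ε) (h₃ : |v₃| ≤ ε) (hεr : ε ≤ r) (hg : 0 < g)
    (kp₁ : |p₁| ≤ K) (kp₂ : |p₂| ≤ K) (kq : |q| ≤ K)
    (hs : 2 * r * v₃ + v₁ ^ 2 + v₂ ^ 2 + v₃ ^ 2 = -g)
    (hε : 16 * (K ^ 2 * ε) ≤ r * (p₁ ^ 2 + p₂ ^ 2)) :
    (p₁ ^ 2 + p₂ ^ 2) / 4 * g ≤
      p₁ * ((p₁ * v₁ + p₂ * v₂ + q * v₃) * v₁ - p₁ * v₃ * (r + v₃)) -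
      p₂ * (p₂ * v₃ * (r + v₃) - (p₁ * v₁ + p₂ * v₂ + q * v₃) * v₂) := by
  have hε0 : 0 ≤ ε := (abs_nonneg _).trans h₁
  have hK0 : 0 ≤ K := (abs_nonneg _).trans kq
  obtain ⟨hrv, hrv2⟩ := parabolic_bounds hr h₃ hεr hg hs
  obtain ⟨G, hG⟩ : ∃ G, G = g + v₁ ^ 2 + v₂ ^ 2 := ⟨_, rfl⟩
  rw [← hG] at hrv hrv2
  have hgG : g ≤ G := by rw [hG]; nlinarith [sq_nonneg v₁, sq_nonneg v₂]
  have hG0 : 0 < G := hg.trans_le hgG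
  obtain ⟨w, hw⟩ : ∃ w, w = p₁ * v₁ + p₂ * v₂ + q * v₃ := ⟨_, rfl⟩
  have hw₃ : |w| ≤ 3 * (K * ε) := by
    have := abs_add_three (p₁ * v₁) (p₂ * v₂) (q * v₃)
    rw [hw]
    linarith [abs_mul_le_mul kp₁ h₁, abs_mul_le_mul kp₂ h₂, abs_mul_le_mul kq h₃]
  have t₁ : (p₁ ^ 2 + p₂ ^ 2) * (r * v₃ ^ 2) ≤ (K ^ 2 + K ^ 2) * (ε * G) := by
    have : p₁ ^ 2 ≤ K ^ 2 := sq_le_sq' (abs_le.1 kp₁).1 (abs_le.1 kp₁).2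
    have : p₂ ^ 2 ≤ K ^ 2 := sq_le_sq' (abs_le.1 kp₂).1 (abs_le.1 kp₂).2
    gcongr
  have t₂ : |q * (r * v₃ * w)| ≤ K * (G * (3 * (K * ε))) :=
    abs_mul_le_mul kq (abs_mul_le_mul hrv hw₃)
  have t₃ : 0 ≤ r * w ^ 2 := by positivity
  have t₄ : 16 * (K ^ 2 * ε) * G ≤ r * (p₁ ^ 2 + p₂ ^ 2) * G :=
    mul_le_mul_of_nonneg_right hε hG0.le
  have hrv₃ : r * v₃ = -(G + v₃ ^ 2) / 2 := by rw [hG]; linarith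
  have key : r * ((p₁ ^ 2 + p₂ ^ 2) / 4 * G) ≤
      r * (p₁ * ((p₁ * v₁ + p₂ * v₂ + q * v₃) * v₁ - p₁ * v₃ * (r + v₃)) -
      p₂ * (p₂ * v₃ * (r + v₃) - (p₁ * v₁ + p₂ * v₂ + q * v₃) * v₂)) := by
    have e : p₁ * ((p₁ * v₁ + p₂ * v₂ + q * v₃) * v₁ - p₁ * v₃ * (r + v₃)) -
        p₂ * (p₂ * v₃ * (r + v₃) - (p₁ * v₁ + p₂ * v₂ + q * v₃) * v₂) =
        (p₁ ^ 2 + p₂ ^ 2) * (G - v₃ ^ 2) / 2 + w ^ 2 - q * v₃ * w := by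
      rw [hw]
      linear_combination -(p₁ ^ 2 + p₂ ^ 2) * hrv₃
    rw [e]
    linarith [(abs_le.1 t₂).2]
  exact (mul_le_mul_of_nonneg_left hgG (by positivity)).trans (le_of_mul_le_mul_left key hr)

theorem not_hasStableOrbits_of_isotropic (hr : 0 < P.r) (hm₁ : P.m₁ = 0) (hm₂ : P.m₂ = 0)
    (hp : 0 < P.p₁ ^ 2 + P.p₂ ^ 2) : ¬ P.HasStableOrbits := by
  intro hst
  obtain ⟨m₁, m₂, p₁, p₂, q, b₁, b₂, b₃, r⟩ := P
  simp only at hr hm₁ hm₂ hp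
  subst hm₁ hm₂
  obtain ⟨K, hK0, -, -, kp₁, kp₂, kq⟩ := exists_entry_bound 0 0 p₁ p₂ q
  set ε := min r (r * (p₁ ^ 2 + p₂ ^ 2) / (16 * K ^ 2)) with hε
  have hε0 : 0 < ε := by positivity
  have hεr : ε ≤ r := min_le_left _ _
  have hεK : 16 * (K ^ 2 * ε) ≤ r * (p₁ ^ 2 + p₂ ^ 2) := by
    have := (le_div_iff₀ (by positivity)).1
      (min_le_right r (r * (p₁ ^ 2 + p₂ ^ 2) / (16 * K ^ 2)))
    linarith
  obtain ⟨δ, hδ, H⟩ := hst ε hε0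
  obtain ⟨η, hη0, hηδ, hηε⟩ : ∃ η : ℝ, 0 < η ∧ η < δ ∧ η < ε := by
    obtain ⟨η, h0, h⟩ := exists_between (lt_min hδ hε0)
    exact ⟨η, h0, h.trans_le (min_le_left _ _), h.trans_le (min_le_right _ _)⟩
  obtain ⟨v₁, v₂, v₃, ho, i₁, i₂, i₃, hv⟩ := H 0 0 (-η) 0 (by simpa using hδ) (by simpa using hδ)
    (by rwa [abs_neg, abs_of_pos hη0]) (by simpa using hδ)
  have hmom : ∀ s, 2 * r * v₃ s + v₁ s ^ 2 + v₂ s ^ 2 + v₃ s ^ 2 = -(η * (2 * r - η)) := by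
    intro s
    have := ho.momentum_eq s
    rw [i₁, i₂, i₃] at this
    linear_combination this
  have hg : 0 < η * (2 * r - η) := mul_pos hη0 (by linarith)
  refine not_bounded_of_deriv_ge (f := fun s => p₁ * v₂ s - p₂ * v₁ s)
    (M := |p₁| * ε + |p₂| * ε)
    (c := (p₁ ^ 2 + p₂ ^ 2) / 4 * (η * (2 * r - η))) (by positivity)
    (fun s => ((ho.deriv₂ s).const_mul p₁).sub ((ho.deriv₁ s).const_mul p₂)) (fun s hs => ?_)
    (fun s hs => (abs_sub _ _).trans (add_le_add (abs_mul_le_mul le_rfl (hv s hs).2.1)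
      (abs_mul_le_mul le_rfl (hv s hs).1)))
  have := isotropic_inequality hr (hv s hs).1 (hv s hs).2.1 (hv s hs).2.2 hεr hg
    kp₁ kp₂ kq (hmom s) hεK
  simpa using this

theorem not_hasStableOrbits_of_drift (hr : 0 < P.r) (hm₂ : P.m₂ = 0) (hp₁ : P.p₁ = 0)
    (hp₂ : P.p₂ = 0) (hq : P.q = 0) (hb₂ : P.b₂ ≠ 0) : ¬ P.HasStableOrbits := by
  intro hst
  obtain ⟨m, m₂, p₁, p₂, q, b₁, b₂, b₃, r⟩ := P
  simp only at hr hm₂ hp₁ hp₂ hq hb₂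
  subst hm₂ hp₁ hp₂ hq
  have hb0 := abs_pos.2 hb₂
  set ε := r * |b₂| / (2 * (|b₂| + |b₃|)) with hε
  have hε0 : 0 < ε := by positivity
  have hεb : 2 * (|b₂| * ε + |b₃| * ε) = r * |b₂| := by
    rw [hε]
    field_simp
  obtain ⟨δ, hδ, H⟩ := hst ε hε0
  obtain ⟨v₁, v₂, v₃, ho, i₁, i₂, i₃, hv⟩ := H 0 0 0 (δ / 2) (by simpa using hδ)
    (by simpa using hδ) (by simpa using hδ) (by rw [abs_of_pos (by positivity)]; linarith)
  refine not_bounded_of_deriv_ge (f := fun s => b₂ * v₁ s) (M := |b₂| * ε)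
    (c := δ / 2 * (r * b₂ ^ 2 / 2)) (by positivity)
    (fun s => (ho.deriv₁ s).const_mul b₂) (fun s hs => ?_)
    (fun s hs => abs_mul_le_mul le_rfl (hv s hs).1)
  simp only [zero_mul, zero_add, add_zero]
  have e : b₂ * (δ / 2 * b₂ * (r + v₃ s) - δ / 2 * b₃ * v₂ s) =
      δ / 2 * (r * b₂ ^ 2 + b₂ * (b₂ * v₃ s) - b₂ * (b₃ * v₂ s)) := by ring
  rw [e]
  refine mul_le_mul_of_nonneg_left ?_ (by positivity)
  have t₁ : |b₂ * (b₂ * v₃ s)| ≤ |b₂| * (|b₂| * ε) :=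
    abs_mul_le_mul le_rfl (abs_mul_le_mul le_rfl (hv s hs).2.2)
  have t₂ : |b₂ * (b₃ * v₂ s)| ≤ |b₂| * (|b₃| * ε) :=
    abs_mul_le_mul le_rfl (abs_mul_le_mul le_rfl (hv s hs).2.1)
  have t₃ : 2 * (|b₂| * (|b₂| * ε) + |b₂| * (|b₃| * ε)) = r * b₂ ^ 2 := by
    rw [← sq_abs b₂]
    linear_combination |b₂| * hεb
  linarith [(abs_le.1 t₁).1, (abs_le.1 t₂).2]

theorem not_hasStableOrbits_of_planar (hr : 0 < P.r) (hm₁ : P.m₁ ≠ 0) (hm₂ : P.m₂ = 0)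
    (hp₂ : P.p₂ = 0) (hD : P.m₁ * P.q - P.p₁ ^ 2 ≤ 0) : ¬ P.HasStableOrbits := by
  intro hst
  obtain ⟨m, m₂, p, p₂, q, b₁, b₂, b₃, r⟩ := P
  simp only at hr hm₁ hm₂ hp₂ hD
  subst hm₂ hp₂
  have hm0 := abs_pos.2 hm₁
  obtain ⟨D, hDdef⟩ : ∃ D, D = m * q - p ^ 2 := ⟨_, rfl⟩
  rw [← hDdef] at hD
  set ε := r * |m| / (2 * (|m| + |p| + (1 - D))) with hε
  have hD1 : 0 < 1 - D := by linarith
  have hε0 : 0 < ε := by positivity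
  have hεm : 2 * (|m| * ε + (|p| + (1 - D)) * ε) = r * |m| := by
    rw [hε]
    field_simp
    ring
  obtain ⟨δ, hδ, H⟩ := hst ε hε0
  obtain ⟨η, hηδ, hη0⟩ : ∃ η : ℝ, |η| < δ ∧ 0 < m * η := by
    rcases lt_or_gt_of_ne hm₁ with h | h
    · exact ⟨-(δ / 2), by rw [abs_neg, abs_of_pos (by positivity)]; linarith, by nlinarith⟩
    · exact ⟨δ / 2, by rw [abs_of_pos (by positivity)]; linarith, by positivity⟩
  obtain ⟨v₁, v₂, v₃, ho, i₁, i₂, i₃, hv⟩ := H η 0 0 0 hηδ (by simpa using hδ) (by simpa using hδ)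
    (by simpa using hδ)
  have hsq : ∀ s, (m * v₁ s + p * v₃ s) ^ 2 + D * v₃ s ^ 2 = (m * η) ^ 2 := by
    intro s
    have := ho.energy_eq s
    rw [i₁, i₂, i₃] at this
    rw [hDdef]
    linear_combination m * this
  have hcont : Continuous fun s => m * v₁ s + p * v₃ s :=
    continuous_iff_continuousAt.2 fun s =>
      (((ho.deriv₁ s).const_mul m).add ((ho.deriv₃ s).const_mul p)).continuousAt
  have hne : ∀ s, m * v₁ s + p * v₃ s ≠ 0 := by
    intro s h
    have := hsq s
    rw [h] at this
    nlinarith [mul_pos hη0 hη0, sq_nonneg (v₃ s), mul_nonneg (neg_nonneg.2 hD) (sq_nonneg (v₃ s))]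
  have hpos : ∀ s, 0 < m * v₁ s + p * v₃ s := by
    intro s
    by_contra! hcon
    obtain ⟨x, -, hx⟩ := isPreconnected_univ.intermediate_value (Set.mem_univ s)
      (Set.mem_univ (0 : ℝ)) hcont.continuousOn
      (show (0 : ℝ) ∈ Set.Icc _ _ from ⟨hcon, by simp only [i₁, i₃]; linarith⟩)
    exact hne x hx
  have hge : ∀ s, m * η ≤ m * v₁ s + p * v₃ s := by
    intro s
    refine le_of_sq_le_sq ?_ (hpos s).le
    nlinarith [hsq s, mul_nonneg (neg_nonneg.2 hD) (sq_nonneg (v₃ s))]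
  refine not_bounded_of_deriv_ge (f := fun s => -|m| * v₂ s) (M := |(-|m|)| * ε)
    (c := r * |m| / 2 * (m * η)) (by positivity)
    (fun s => (ho.deriv₂ s).const_mul (-|m|)) (fun s hs => ?_)
    (fun s hs => abs_mul_le_mul le_rfl (hv s hs).2.1)
  have hw0 := hpos s
  have hw := hge s
  have hw2 := hsq s
  obtain ⟨h₁, h₂, h₃⟩ := hv s hs
  obtain ⟨w, hwdef⟩ : ∃ w, w = m * v₁ s + p * v₃ s := ⟨_, rfl⟩
  have hw₃ : |m * (p * v₁ s + q * v₃ s)| ≤ (|p| + (1 - D)) * w := by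
    have e : m * (p * v₁ s + q * v₃ s) = p * w + D * v₃ s := by rw [hwdef, hDdef]; ring
    have e' : |D * v₃ s| ≤ (1 - D) * w := by
      refine abs_le_of_sq_le_sq ?_ (mul_nonneg hD1.le (by rw [hwdef]; exact hw0.le))
      have h₀ : -D * v₃ s ^ 2 ≤ w ^ 2 := by rw [hwdef]; nlinarith [mul_pos hη0 hη0]
      calc (D * v₃ s) ^ 2 = -D * (-D * v₃ s ^ 2) := by ring
        _ ≤ -D * w ^ 2 := mul_le_mul_of_nonneg_left h₀ (by linarith)
        _ ≤ (1 - D) ^ 2 * w ^ 2 := mul_le_mul_of_nonneg_right (by nlinarith) (sq_nonneg _)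
        _ = ((1 - D) * w) ^ 2 := by ring
    have e'' : |p * w| = |p| * w := by
      rw [abs_mul, abs_of_pos (show 0 < w by rw [hwdef]; exact hw0)]
    rw [e]
    linarith [abs_add_le (p * w) (D * v₃ s)]
  have t₁ : |m * (p * v₁ s + q * v₃ s) * v₁ s| ≤ (|p| + (1 - D)) * w * ε := abs_mul_le_mul hw₃ h₁
  have t₁' : |(|m|) * ((p * v₁ s + q * v₃ s) * v₁ s)| ≤ (|p| + (1 - D)) * w * ε := by
    rw [abs_mul, abs_abs, ← abs_mul, ← mul_assoc]
    exact t₁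
  have t₂ : |w * (|m| * v₃ s)| ≤ w * (|m| * ε) :=
    abs_mul_le_mul (by rw [abs_of_pos (by rw [hwdef]; exact hw0)])
      (abs_mul_le_mul (by rw [abs_abs]) h₃)
  rw [← hwdef] at hw
  have t₃ : r * |m| / 2 * (m * η) ≤ r * |m| / 2 * w :=
    mul_le_mul_of_nonneg_left hw (by positivity)
  have e : -|m| * ((p * v₁ s + 0 * v₂ s + q * v₃ s + 0 * b₃) * v₁ s -
      (m * v₁ s + p * v₃ s + 0 * b₁) * (r + v₃ s)) =
      r * |m| * w + w * (|m| * v₃ s) - |m| * ((p * v₁ s + q * v₃ s) * v₁ s) := by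
    rw [hwdef]
    ring
  have e₂ : 2 * (w * (|m| * ε) + (|p| + (1 - D)) * w * ε) = r * |m| * w := by
    linear_combination w * hεm
  simp only
  rw [e]
  linarith [(abs_le.1 t₁').2, (abs_le.1 t₂).1]

end GyrostatParams
namespace LieStructure

variable {g : Type*} [NormedAddCommGroup g] [InnerProductSpace ℝ g]
variable (L : LieStructure g)

theorem bracket_swap (U V : g) : L.bracket V U = -L.bracket U V := by
  have h := L.bracket_self (U + V)
  simp only [map_add, LinearMap.add_apply, L.bracket_self, zero_add, add_zero] at h
  exact eq_neg_of_add_eq_zero_left h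

theorem orthonormal_of_unit_pair {a b : g} (ha : ⟪a, a⟫_ℝ = 1) (hb : ⟪b, b⟫_ℝ = 1)
    (hab : ⟪a, b⟫_ℝ = 0) :
    Orthonormal ℝ (({2, 3} : Set (Fin 4)).domRestrict ![0, 0, a, b]) := by
  have hba : ⟪b, a⟫_ℝ = 0 := by rw [real_inner_comm, hab]
  rw [orthonormal_iff_ite]
  rintro ⟨i, hi⟩ ⟨j, hj⟩
  rcases hi with rfl | rfl <;> rcases hj with rfl | rfl <;>
    simp_all [Set.domRestrict, -inner_self_eq_norm_sq_to_K, Subtype.ext_iff, -Subtype.mk.injEq]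

/-- Unimodularity makes the structure matrix of the bracket symmetric. -/
theorem IsUnimodular.inner_bracket_symm {L : LieStructure g} (huni : L.IsUnimodular)
    (e : OrthonormalBasis (Fin 4) ℝ g) (h3 : L.bracket (e 3) = 0) :
    ⟪e 1, L.bracket (e 1) (e 2)⟫_ℝ = ⟪e 0, L.bracket (e 2) (e 0)⟫_ℝ ∧
      ⟪e 2, L.bracket (e 1) (e 2)⟫_ℝ = ⟪e 0, L.bracket (e 0) (e 1)⟫_ℝ ∧
      ⟪e 2, L.bracket (e 2) (e 0)⟫_ℝ = ⟪e 1, L.bracket (e 0) (e 1)⟫_ℝ := by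
  have hc : ∀ U, L.bracket U (e 3) = 0 := fun U => by simp [L.bracket_swap (e 3) U, h3]
  have h : ∀ i, ∑ j, ⟪e j, L.bracket (e i) (e j)⟫_ℝ = 0 := fun i => by
    rw [← huni (e i), LinearMap.trace_eq_sum_inner _ e]
    rfl
  have t0 := h 0
  have t1 := h 1
  have t2 := h 2
  simp only [Fin.sum_univ_four, L.bracket_self, hc, inner_zero_right, add_zero, zero_add]
    at t0 t1 t2
  rw [L.bracket_swap (e 2) (e 0), inner_neg_right] at t0
  rw [L.bracket_swap (e 0) (e 1), inner_neg_right] at t1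
  rw [L.bracket_swap (e 1) (e 2), inner_neg_right] at t2
  exact ⟨by linarith, by linarith, by linarith⟩

/-- An orthonormal frame `e` with `e 3` central whose bracket is given, transversally to
`e 3`, by a symmetric matrix with vanishing `(0, 1)` entry. -/
structure EulerFrame where
  basis : OrthonormalBasis (Fin 4) ℝ g
  (a₀ a₁ a₂ p₀ p₁ b₀ b₁ b₂ : ℝ)
  inner_bracket : ∀ U V W : g, ⟪W, L.bracket U V⟫_ℝ =
    (⟪basis 1, U⟫_ℝ * ⟪basis 2, V⟫_ℝ - ⟪basis 2, U⟫_ℝ * ⟪basis 1, V⟫_ℝ) *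
      (a₀ * ⟪basis 0, W⟫_ℝ + p₀ * ⟪basis 2, W⟫_ℝ + b₀ * ⟪basis 3, W⟫_ℝ) +
    (⟪basis 2, U⟫_ℝ * ⟪basis 0, V⟫_ℝ - ⟪basis 0, U⟫_ℝ * ⟪basis 2, V⟫_ℝ) *
      (a₁ * ⟪basis 1, W⟫_ℝ + p₁ * ⟪basis 2, W⟫_ℝ + b₁ * ⟪basis 3, W⟫_ℝ) +
    (⟪basis 0, U⟫_ℝ * ⟪basis 1, V⟫_ℝ - ⟪basis 1, U⟫_ℝ * ⟪basis 0, V⟫_ℝ) *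
      (p₀ * ⟪basis 0, W⟫_ℝ + p₁ * ⟪basis 1, W⟫_ℝ + a₂ * ⟪basis 2, W⟫_ℝ + b₂ * ⟪basis 3, W⟫_ℝ)

variable {L}

theorem exists_eulerFrame_of_basis (huni : L.IsUnimodular) (e : OrthonormalBasis (Fin 4) ℝ g)
    (h3 : L.bracket (e 3) = 0) (h0 : ⟪e 1, L.bracket (e 1) (e 2)⟫_ℝ = 0) :
    ∃ F : L.EulerFrame, F.basis = e := by
  obtain ⟨s1, s2, s3⟩ := huni.inner_bracket_symm e h3
  have hc : ∀ U, L.bracket U (e 3) = 0 := fun U => by simp [L.bracket_swap (e 3) U, h3]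
  refine ⟨⟨e, ⟪e 0, L.bracket (e 1) (e 2)⟫_ℝ, ⟪e 1, L.bracket (e 2) (e 0)⟫_ℝ,
    ⟪e 2, L.bracket (e 0) (e 1)⟫_ℝ, ⟪e 2, L.bracket (e 1) (e 2)⟫_ℝ,
    ⟪e 2, L.bracket (e 2) (e 0)⟫_ℝ, ⟪e 3, L.bracket (e 1) (e 2)⟫_ℝ,
    ⟪e 3, L.bracket (e 2) (e 0)⟫_ℝ, ⟪e 3, L.bracket (e 0) (e 1)⟫_ℝ, fun U V W => ?_⟩, rfl⟩
  have hUV : L.bracket U V =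
      (⟪e 1, U⟫_ℝ * ⟪e 2, V⟫_ℝ - ⟪e 2, U⟫_ℝ * ⟪e 1, V⟫_ℝ) • L.bracket (e 1) (e 2) +
      (⟪e 2, U⟫_ℝ * ⟪e 0, V⟫_ℝ - ⟪e 0, U⟫_ℝ * ⟪e 2, V⟫_ℝ) • L.bracket (e 2) (e 0) +
      (⟪e 0, U⟫_ℝ * ⟪e 1, V⟫_ℝ - ⟪e 1, U⟫_ℝ * ⟪e 0, V⟫_ℝ) • L.bracket (e 0) (e 1) := by
    conv_lhs => rw [← e.sum_repr' U, ← e.sum_repr' V]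
    simp only [Fin.sum_univ_four, map_add, map_smul, LinearMap.add_apply, LinearMap.smul_apply,
      L.bracket_self, hc, h3, LinearMap.zero_apply, L.bracket_swap (e 1) (e 2),
      L.bracket_swap (e 2) (e 0), L.bracket_swap (e 0) (e 1)]
    module
  have hW : ∀ C, ⟪W, C⟫_ℝ = ⟪e 0, W⟫_ℝ * ⟪e 0, C⟫_ℝ + ⟪e 1, W⟫_ℝ * ⟪e 1, C⟫_ℝ +
      ⟪e 2, W⟫_ℝ * ⟪e 2, C⟫_ℝ + ⟪e 3, W⟫_ℝ * ⟪e 3, C⟫_ℝ := fun C => by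
    rw [← e.sum_inner_mul_inner W C, Fin.sum_univ_four]
    simp only [real_inner_comm W]
  rw [hUV]
  simp only [inner_add_right, inner_smul_right]
  rw [hW (L.bracket (e 1) (e 2)), hW (L.bracket (e 2) (e 0)), hW (L.bracket (e 0) (e 1)), h0,
    ← s1, h0, ← s2, ← s3]
  ring

variable [FiniteDimensional ℝ g]

/-- An orthonormal frame with prescribed last vector (up to scaling) and with `X` in the
span of the last two vectors. -/
theorem exists_adapted_orthonormalBasis (hdim : Module.finrank ℝ g = 4) {Z : g} (hZ : Z ≠ 0)
    (X : g) : ∃ (e : OrthonormalBasis (Fin 4) ℝ g) (r c ζ : ℝ), 0 ≤ r ∧ ζ ≠ 0 ∧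
      X = r • e 2 + c • e 3 ∧ Z = ζ • e 3 := by
  set z := ‖Z‖⁻¹ • Z with hz
  have hZn : ‖Z‖ ≠ 0 := norm_ne_zero_iff.2 hZ
  have hzz : ⟪z, z⟫_ℝ = 1 := by
    rw [real_inner_self_eq_norm_sq, hz, norm_smul, norm_inv, norm_norm, inv_mul_cancel₀ hZn,
      one_pow]
  have hZz : Z = ‖Z‖ • z := by rw [hz, smul_smul, mul_inv_cancel₀ hZn, one_smul]
  set x := X - ⟪z, X⟫_ℝ • z with hx
  have hXx : X = x + ⟪z, X⟫_ℝ • z := by rw [hx]; abel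
  have hzx : ⟪z, x⟫_ℝ = 0 := by
    rw [hx, inner_sub_right, inner_smul_right, hzz, mul_one, sub_self]
  obtain ⟨u, huu, huz, r, hr, hxr⟩ : ∃ u : g, ⟪u, u⟫_ℝ = 1 ∧ ⟪u, z⟫_ℝ = 0 ∧
      ∃ r : ℝ, 0 ≤ r ∧ x = r • u := by
    by_cases h0 : x = 0
    · obtain ⟨e, he⟩ := Orthonormal.exists_orthonormalBasis_extension_of_card_eq (𝕜 := ℝ)
        (E := g) (ι := Fin 4) (v := fun _ => z) (s := {3}) (by simp [hdim]) (by
          rw [orthonormal_iff_ite]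
          rintro ⟨i, hi⟩ ⟨j, hj⟩
          rcases hi with rfl
          rcases hj with rfl
          simpa [Set.domRestrict] using hzz)
      refine ⟨e 2, by simp, ?_, 0, le_rfl, by simp [h0]⟩
      rw [← he 3 rfl]
      simp [e.inner_eq_ite]
    · have hn : ‖x‖ ≠ 0 := norm_ne_zero_iff.2 h0
      refine ⟨‖x‖⁻¹ • x, ?_, ?_, ‖x‖, norm_nonneg _, ?_⟩
      · rw [real_inner_self_eq_norm_sq, norm_smul, norm_inv, norm_norm, inv_mul_cancel₀ hn,
          one_pow]
      · rw [inner_smul_left, real_inner_comm, hzx, mul_zero]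
      · rw [smul_smul, mul_inv_cancel₀ hn, one_smul]
  obtain ⟨e, he⟩ := Orthonormal.exists_orthonormalBasis_extension_of_card_eq (𝕜 := ℝ)
    (by simp [hdim]) (orthonormal_of_unit_pair huu hzz huz)
  have h2 : e 2 = u := he 2 (by simp)
  have h3 : e 3 = z := he 3 (by simp)
  refine ⟨e, r, ⟪z, X⟫_ℝ, ‖Z‖, hr, hZn, ?_, ?_⟩
  · rw [h2, h3, ← hxr]; exact hXx
  · rw [h3]; exact hZz

theorem exists_rotated_orthonormalBasis (huni : L.IsUnimodular)
    (e : OrthonormalBasis (Fin 4) ℝ g) (h3 : L.bracket (e 3) = 0) :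
    ∃ f : OrthonormalBasis (Fin 4) ℝ g, f 2 = e 2 ∧ f 3 = e 3 ∧
      ⟪f 1, L.bracket (f 1) (f 2)⟫_ℝ = 0 := by
  obtain ⟨s1, -, -⟩ := huni.inner_bracket_symm e h3
  let u : ℝ → g := fun θ => Real.cos θ • e 0 + Real.sin θ • e 1
  let w : ℝ → g := fun θ => -Real.sin θ • e 0 + Real.cos θ • e 1
  have hw : Continuous w := by fun_prop
  let G : ℝ → ℝ := fun θ => ⟪w θ, L.bracket.toContinuousBilinearMap (w θ) (e 2)⟫_ℝ
  have hG : Continuous G := by fun_prop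
  have hG0 : G 0 = ⟪e 1, L.bracket (e 1) (e 2)⟫_ℝ := by simp [G, w]
  have hG1 : G (Real.pi / 2) = -⟪e 1, L.bracket (e 1) (e 2)⟫_ℝ := by
    simp [G, w, s1, L.bracket_swap (e 2) (e 0)]
  obtain ⟨θ, hθ⟩ : ∃ θ, G θ = 0 := by
    rcases le_total (G 0) 0 with h | h
    · exact mem_range_of_exists_le_of_exists_ge hG ⟨0, h⟩ ⟨Real.pi / 2, by linarith⟩
    · exact mem_range_of_exists_le_of_exists_ge hG ⟨Real.pi / 2, by linarith⟩ ⟨0, h⟩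
  have hcs := Real.sin_sq_add_cos_sq θ
  obtain ⟨f, hf⟩ := Orthonormal.exists_orthonormalBasis_extension_of_card_eq (𝕜 := ℝ)
    (E := g) (ι := Fin 4) (v := ![u θ, w θ, e 2, e 3]) (s := Set.univ)
    (Module.finrank_eq_card_basis e.toBasis) (by
      rw [orthonormal_iff_ite]
      rintro ⟨i, -⟩ ⟨j, -⟩
      fin_cases i <;> fin_cases j <;>
        simp [Set.domRestrict, u, w, inner_add_left, inner_add_right, inner_smul_left,
          inner_smul_right, e.inner_eq_ite, -inner_self_eq_norm_sq_to_K] <;> nlinarith)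
  refine ⟨f, hf 2 trivial, hf 3 trivial, ?_⟩
  rw [hf 1 trivial, hf 2 trivial]
  exact hθ

theorem exists_eulerFrame (hdim : Module.finrank ℝ g = 4) (huni : L.IsUnimodular) {Z : g}
    (hZ : Z ∈ L.center) (hZ0 : Z ≠ 0) (X : g) : ∃ (F : L.EulerFrame) (r c ζ : ℝ), 0 ≤ r ∧ ζ ≠ 0 ∧
      X = r • F.basis 2 + c • F.basis 3 ∧ Z = ζ • F.basis 3 := by
  obtain ⟨e, r, c, ζ, hr, hζ, hXe, hZe⟩ := exists_adapted_orthonormalBasis hdim hZ0 X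
  have h3 : L.bracket (e 3) = 0 := by
    have h : L.bracket Z = 0 := hZ
    rw [hZe, map_smul] at h
    exact (smul_eq_zero.1 h).resolve_left hζ
  obtain ⟨f, hf2, hf3, hf0⟩ := exists_rotated_orthonormalBasis huni e h3
  obtain ⟨F, rfl⟩ := exists_eulerFrame_of_basis huni f (by rw [hf3, h3]) hf0
  exact ⟨F, r, c, ζ, hr, hζ, by rw [hf2, hf3, hXe], by rw [hf3, hZe]⟩

end LieStructure
namespace GyrostatParams

variable {P : GyrostatParams}

/-- Parameters `P` coming from a stationary point with central component `c`. -/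
structure IsRelative (P : GyrostatParams) (c : ℝ) : Prop where
  rel₁ : P.r * P.p₁ + c * P.b₁ = 0
  rel₂ : P.r * P.p₂ + c * P.b₂ = 0
  rel₃ : P.r * P.q + c * P.b₃ = 0

theorem IsRelative.swap {c : ℝ} (h : P.IsRelative c) : P.swap.IsRelative c :=
  ⟨h.rel₂, by simp only [GyrostatParams.swap]; linarith [h.rel₁], h.rel₃⟩

theorem HasStableOrbits.mul_nonneg (hr : 0 < P.r) (h : P.HasStableOrbits) : 0 ≤ P.m₁ * P.m₂ := by
  by_contra! hm
  rcases mul_neg_iff.1 hm with ⟨h1, h2⟩ | ⟨h1, h2⟩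
  · exact not_hasStableOrbits_of_saddle (P := P.swap) hr h2 h1 h.swap
  · exact not_hasStableOrbits_of_saddle hr h1 h2 h

theorem HasStableOrbits.planar {c : ℝ} (hr : 0 < P.r) (hc : P.IsRelative c)
    (h : P.HasStableOrbits) (hm₁ : P.m₁ ≠ 0) (hm₂ : P.m₂ = 0) :
    P.p₂ = 0 ∧ P.b₂ = 0 ∧ P.p₁ ^ 2 < P.m₁ * P.q := by
  have hp₂ : P.p₂ = 0 := by
    by_contra hp
    exact not_hasStableOrbits_of_degenerate hr hm₁ hm₂ hp h
  have hq : P.p₁ ^ 2 < P.m₁ * P.q := by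
    by_contra! hq
    exact not_hasStableOrbits_of_planar hr hm₁ hm₂ hp₂ (by linarith) h
  refine ⟨hp₂, ?_, hq⟩
  have h2 := hc.rel₂
  rw [hp₂, mul_zero, zero_add] at h2
  refine (mul_eq_zero.1 h2).resolve_left fun hc0 => ?_
  have h3 := hc.rel₃
  rw [hc0, zero_mul, add_zero] at h3
  rw [(mul_eq_zero.1 h3).resolve_left hr.ne', mul_zero] at hq
  linarith [sq_nonneg P.p₁]

theorem HasStableOrbits.trivial {c : ℝ} (hr : 0 < P.r) (hc : P.IsRelative c)
    (h : P.HasStableOrbits) (hm₁ : P.m₁ = 0) (hm₂ : P.m₂ = 0) :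
    P.p₁ = 0 ∧ P.p₂ = 0 ∧ P.b₁ = 0 ∧ P.b₂ = 0 := by
  obtain ⟨hp₁, hp₂⟩ : P.p₁ = 0 ∧ P.p₂ = 0 := by
    by_contra hp
    refine not_hasStableOrbits_of_isotropic hr hm₁ hm₂ ?_ h
    rcases not_and_or.1 hp with hp | hp <;> positivity
  by_cases hc0 : c = 0
  · have hq : P.q = 0 := by
      have h3 := hc.rel₃
      rw [hc0, zero_mul, add_zero] at h3
      exact (mul_eq_zero.1 h3).resolve_left hr.ne'
    refine ⟨hp₁, hp₂, ?_, ?_⟩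
    · by_contra hb
      exact not_hasStableOrbits_of_drift (P := P.swap) hr hm₁ hp₂ (neg_eq_zero.2 hp₁) hq
        (neg_ne_zero.2 hb) h.swap
    · by_contra hb
      exact not_hasStableOrbits_of_drift hr hm₂ hp₁ hp₂ hq hb h
  · have h1 := hc.rel₁
    have h2 := hc.rel₂
    simp only [hp₁, hp₂, mul_zero, zero_add, mul_eq_zero, hc0, false_or] at h1 h2
    exact ⟨hp₁, hp₂, h1, h2⟩

/-- The integrals of momentum and energy (at `t = 0`) have an isolated common zero at the
origin. -/
def IsolatedByIntegrals (P : GyrostatParams) : Prop :=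
  ∃ ρ > 0, ∀ v₁ v₂ v₃ : ℝ, |v₁| ≤ ρ → |v₂| ≤ ρ → |v₃| ≤ ρ →
    2 * P.r * v₃ + v₁ ^ 2 + v₂ ^ 2 + v₃ ^ 2 = 0 →
    P.m₁ * v₁ ^ 2 + P.m₂ * v₂ ^ 2 + P.q * v₃ ^ 2 + 2 * (P.p₁ * (v₁ * v₃)) +
      2 * (P.p₂ * (v₂ * v₃)) = 0 → v₁ = 0 ∧ v₂ = 0 ∧ v₃ = 0

theorem IsolatedByIntegrals.of_swap (h : P.swap.IsolatedByIntegrals) : P.IsolatedByIntegrals := by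
  obtain ⟨ρ, hρ, H⟩ := h
  refine ⟨ρ, hρ, fun v₁ v₂ v₃ h₁ h₂ h₃ hS hQ => ?_⟩
  obtain ⟨i₁, i₂, i₃⟩ := H v₂ (-v₁) v₃ h₂ (by rwa [abs_neg]) h₃
    (by simp only [GyrostatParams.swap]; linarith)
    (by simp only [GyrostatParams.swap]; linarith)
  exact ⟨neg_eq_zero.1 i₂, i₁, i₃⟩

/-- Changing the sign of the energy. -/
theorem IsolatedByIntegrals.of_neg {m₁ m₂ p₁ p₂ q b₁ b₂ b₃ r : ℝ}
    (h : IsolatedByIntegrals ⟨-m₁, -m₂, -p₁, -p₂, -q, b₁, b₂, b₃, r⟩) :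
    IsolatedByIntegrals ⟨m₁, m₂, p₁, p₂, q, b₁, b₂, b₃, r⟩ := by
  obtain ⟨ρ, hρ, H⟩ := h
  refine ⟨ρ, hρ, fun v₁ v₂ v₃ h₁ h₂ h₃ hS hQ => H v₁ v₂ v₃ h₁ h₂ h₃ hS ?_⟩
  simp only at hQ ⊢
  linarith

theorem isolatedByIntegrals_of_pos (hr : 0 < P.r) (hm₁ : 0 < P.m₁) (hm₂ : 0 < P.m₂) :
    P.IsolatedByIntegrals := by
  obtain ⟨m₁, m₂, p₁, p₂, q, b₁, b₂, b₃, r⟩ := P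
  simp only at hr hm₁ hm₂
  obtain ⟨K, hK0, -, -, kp₁, kp₂, kq⟩ := exists_entry_bound m₁ m₂ p₁ p₂ q
  set κ := min m₁ m₂ with hκ
  have hκ0 : 0 < κ := lt_min hm₁ hm₂
  set ρ := min r (r * κ / (10 * K)) with hρ
  have hρ0 : 0 < ρ := by positivity
  have hρr : ρ ≤ r := min_le_left _ _
  have hρK : 10 * (K * ρ) ≤ r * κ := by
    have := (le_div_iff₀ (by positivity)).1 (min_le_right r (r * κ / (10 * K)))
    linarith
  refine ⟨ρ, hρ0, fun v₁ v₂ v₃ h₁ h₂ h₃ hS hQ => ?_⟩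
  simp only at hS hQ
  obtain ⟨N, hN⟩ : ∃ N, N = v₁ ^ 2 + v₂ ^ 2 := ⟨_, rfl⟩
  have hN0 : 0 ≤ N := by rw [hN]; positivity
  have hv₃ : v₃ ≤ 0 := by nlinarith [sq_nonneg v₁, sq_nonneg v₂, sq_nonneg v₃]
  have hw : |v₃| * r ≤ N := by
    rw [abs_of_nonpos hv₃] at h₃ ⊢
    nlinarith
  have hκN : κ * N ≤ m₁ * v₁ ^ 2 + m₂ * v₂ ^ 2 := by
    rw [hN, mul_add]
    exact add_le_add (mul_le_mul_of_nonneg_right (min_le_left m₁ m₂) (sq_nonneg v₁))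
      (mul_le_mul_of_nonneg_right (min_le_right m₁ m₂) (sq_nonneg v₂))
  have e₁ : |p₁ * (v₁ * v₃)| ≤ K * (ρ * |v₃|) :=
    abs_mul_le_mul kp₁ (abs_mul_le_mul h₁ le_rfl)
  have e₂ : |p₂ * (v₂ * v₃)| ≤ K * (ρ * |v₃|) :=
    abs_mul_le_mul kp₂ (abs_mul_le_mul h₂ le_rfl)
  have e₃ : |q * (v₃ * v₃)| ≤ K * (ρ * |v₃|) :=
    abs_mul_le_mul kq (abs_mul_le_mul h₃ le_rfl)
  have h5 : κ * N ≤ 5 * (K * (ρ * |v₃|)) := by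
    rw [← sq] at e₃
    linarith [neg_abs_le (p₁ * (v₁ * v₃)), neg_abs_le (p₂ * (v₂ * v₃)), neg_abs_le (q * v₃ ^ 2)]
  have h6 : r * κ * N ≤ 5 * (K * ρ) * N := by
    have := mul_le_mul_of_nonneg_left hw (show 0 ≤ 5 * (K * ρ) by positivity)
    have := mul_le_mul_of_nonneg_left h5 hr.le
    linarith
  have hN' : N = 0 := by
    by_contra hne
    have hNpos : 0 < N := lt_of_le_of_ne hN0 (Ne.symm hne)
    have := le_of_mul_le_mul_right h6 hNpos
    have : 0 < K * ρ := by positivity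
    linarith
  rw [hN'] at hw
  have hv : v₃ = 0 := abs_nonpos_iff.1 (nonpos_of_mul_nonpos_left hw hr)
  obtain ⟨hv₁, hv₂⟩ := (add_eq_zero_iff_of_nonneg (sq_nonneg v₁) (sq_nonneg v₂)).1
    (hN.symm.trans hN')
  exact ⟨pow_eq_zero_iff two_ne_zero |>.1 hv₁, pow_eq_zero_iff two_ne_zero |>.1 hv₂, hv⟩

theorem isolatedByIntegrals_of_mul_pos (hr : 0 < P.r) (hm : 0 < P.m₁ * P.m₂) :
    P.IsolatedByIntegrals := by
  rcases mul_pos_iff.1 hm with ⟨h1, h2⟩ | ⟨h1, h2⟩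
  · exact isolatedByIntegrals_of_pos hr h1 h2
  · exact .of_neg (isolatedByIntegrals_of_pos hr (neg_pos.2 h1) (neg_pos.2 h2))

theorem isolatedByIntegrals_of_planar (hm₁ : P.m₁ ≠ 0) (hm₂ : P.m₂ = 0) (hp₂ : P.p₂ = 0)
    (hq : P.p₁ ^ 2 < P.m₁ * P.q) : P.IsolatedByIntegrals := by
  refine ⟨1, one_pos, fun v₁ v₂ v₃ _ _ _ hS hQ => ?_⟩
  rw [hm₂, hp₂] at hQ
  have hsum : (P.m₁ * v₁ + P.p₁ * v₃) ^ 2 + (P.m₁ * P.q - P.p₁ ^ 2) * v₃ ^ 2 = 0 := by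
    linear_combination P.m₁ * hQ
  have hv₃ : v₃ = 0 := by
    by_contra hne
    have : 0 < (P.m₁ * P.q - P.p₁ ^ 2) * v₃ ^ 2 := mul_pos (by linarith) (by positivity)
    linarith [sq_nonneg (P.m₁ * v₁ + P.p₁ * v₃)]
  have hv₁ : v₁ = 0 := by simpa [hv₃, hm₁] using hsum
  exact ⟨hv₁, by simpa [hv₃, hv₁] using hS, hv₃⟩

end GyrostatParams
namespace LieStructure.EulerFrame

variable {g : Type*} [NormedAddCommGroup g] [InnerProductSpace ℝ g]
variable {L : LieStructure g} (F : L.EulerFrame)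

theorem bracket_basis_three : L.bracket (F.basis 3) = 0 := by
  ext V
  refine ext_inner_left ℝ fun W => ?_
  rw [F.inner_bracket]
  simp

theorem abs_inner_basis_le (i : Fin 4) (U : g) : |⟪F.basis i, U⟫_ℝ| ≤ ‖U‖ := by
  simpa using abs_real_inner_le_norm (F.basis i) U

theorem norm_smul_basis (a : ℝ) (i : Fin 4) : ‖a • F.basis i‖ = |a| := by
  rw [norm_smul, F.basis.norm_eq_one, mul_one, Real.norm_eq_abs]

/-- The point with transversal part `r • e 2` and central part `c • e 3`. -/
noncomputable def point (r c : ℝ) : g := r • F.basis 2 + c • F.basis 3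

@[simp] theorem inner_zero_point (r c : ℝ) : ⟪F.basis 0, F.point r c⟫_ℝ = 0 := by
  simp [point, inner_add_right, inner_smul_right]

@[simp] theorem inner_one_point (r c : ℝ) : ⟪F.basis 1, F.point r c⟫_ℝ = 0 := by
  simp [point, inner_add_right, inner_smul_right]

@[simp] theorem inner_two_point (r c : ℝ) : ⟪F.basis 2, F.point r c⟫_ℝ = r := by
  simp [point, inner_add_right, inner_smul_right]

@[simp] theorem inner_three_point (r c : ℝ) : ⟪F.basis 3, F.point r c⟫_ℝ = c := by
  simp [point, inner_add_right, inner_smul_right]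

/-- The gyrostat parameters at `F.point r c`, with multiplier `l`. -/
noncomputable def params (r l : ℝ) : GyrostatParams :=
  ⟨F.a₀ - l, F.a₁ - l, F.p₀, F.p₁, F.a₂ - l, F.b₀, F.b₁, F.b₂, r⟩

theorem point_zero_mem_center (c : ℝ) : F.point 0 c ∈ L.center := by
  change L.bracket _ = 0
  rw [point, zero_smul, zero_add, map_smul, F.bracket_basis_three, smul_zero]

end LieStructure.EulerFrame

namespace LieStructure

variable {g : Type*} [NormedAddCommGroup g] [InnerProductSpace ℝ g] [FiniteDimensional ℝ g]
variable {L : LieStructure g}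

theorem inner_J (X Y U : g) :
    ⟪U, L.J X Y⟫_ℝ = ⟪Y, L.bracket X U⟫_ℝ + ⟪X, L.bracket Y U⟫_ℝ := by
  change ⟪U, L.adT X Y + L.adT Y X⟫_ℝ = _
  rw [inner_add_right, inner_adT, inner_adT]

/-- If `⟨X, ·⟩` is a first integral then `X` is stable, since the norm is a first integral. -/
theorem isStable_of_inner_bracket_eq_zero {X : g} (h : ∀ Y, ⟪Y, L.bracket Y X⟫_ℝ = 0) :
    L.IsStable X := by
  refine fun ε hε => ⟨ε, hε, fun Y hY h0 t _ => ?_⟩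
  have hd : ∀ t, HasDerivAt (fun t => ⟪Y t - X, Y t - X⟫_ℝ) 0 t := by
    intro t
    have h1 := ((hY t).sub_const X).inner ℝ ((hY t).sub_const X)
    have h2 : ⟪Y t - X, L.adT (Y t) (Y t)⟫_ℝ = 0 := by
      rw [inner_adT, map_sub, L.bracket_self, inner_sub_right, h, inner_zero_right, sub_zero]
    rwa [real_inner_comm (Y t - X) (L.adT (Y t) (Y t)), h2, add_zero] at h1
  have hc : ⟪Y t - X, Y t - X⟫_ℝ = ⟪Y 0 - X, Y 0 - X⟫_ℝ :=
    eq_initial_of_hasDerivAt_zero hd (fun _ => rfl) t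
  rw [real_inner_self_eq_norm_sq, real_inner_self_eq_norm_sq] at hc
  rwa [(sq_eq_sq₀ (norm_nonneg _) (norm_nonneg _)).1 hc]

theorem isStable_of_J_eq_zero {X : g} (h : L.J X = 0) : L.IsStable X :=
  isStable_of_inner_bracket_eq_zero fun Y => by
    have h1 := inner_J (L := L) X Y Y
    rw [h, LinearMap.zero_apply, inner_zero_right, L.bracket_self, inner_zero_right, add_zero] at h1
    rw [bracket_swap, inner_neg_right, ← h1, neg_zero]

theorem isStable_of_mem_center {X : g} (h : X ∈ L.center) : L.IsStable X :=
  isStable_of_inner_bracket_eq_zero fun Y => by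
    have h1 : L.bracket X = 0 := h
    rw [bracket_swap, h1, LinearMap.zero_apply, neg_zero, inner_zero_right]

namespace EulerFrame

variable (F : L.EulerFrame)

theorem inner_adT_zero (W Y : g) : ⟪F.basis 0, L.adT Y W⟫_ℝ =
    ⟪F.basis 2, Y⟫_ℝ *
      (F.a₁ * ⟪F.basis 1, W⟫_ℝ + F.p₁ * ⟪F.basis 2, W⟫_ℝ + F.b₁ * ⟪F.basis 3, W⟫_ℝ) -
    ⟪F.basis 1, Y⟫_ℝ * (F.p₀ * ⟪F.basis 0, W⟫_ℝ + F.p₁ * ⟪F.basis 1, W⟫_ℝ +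
      F.a₂ * ⟪F.basis 2, W⟫_ℝ + F.b₂ * ⟪F.basis 3, W⟫_ℝ) := by
  rw [inner_adT, F.inner_bracket]
  simp
  ring

theorem inner_adT_one (W Y : g) : ⟪F.basis 1, L.adT Y W⟫_ℝ =
    ⟪F.basis 0, Y⟫_ℝ * (F.p₀ * ⟪F.basis 0, W⟫_ℝ + F.p₁ * ⟪F.basis 1, W⟫_ℝ +
      F.a₂ * ⟪F.basis 2, W⟫_ℝ + F.b₂ * ⟪F.basis 3, W⟫_ℝ) -
    ⟪F.basis 2, Y⟫_ℝ *
      (F.a₀ * ⟪F.basis 0, W⟫_ℝ + F.p₀ * ⟪F.basis 2, W⟫_ℝ + F.b₀ * ⟪F.basis 3, W⟫_ℝ) := by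
  rw [inner_adT, F.inner_bracket]
  simp
  ring

theorem inner_adT_two (W Y : g) : ⟪F.basis 2, L.adT Y W⟫_ℝ =
    ⟪F.basis 1, Y⟫_ℝ *
      (F.a₀ * ⟪F.basis 0, W⟫_ℝ + F.p₀ * ⟪F.basis 2, W⟫_ℝ + F.b₀ * ⟪F.basis 3, W⟫_ℝ) -
    ⟪F.basis 0, Y⟫_ℝ *
      (F.a₁ * ⟪F.basis 1, W⟫_ℝ + F.p₁ * ⟪F.basis 2, W⟫_ℝ + F.b₁ * ⟪F.basis 3, W⟫_ℝ) := by
  rw [inner_adT, F.inner_bracket]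
  simp
  ring

theorem inner_adT_three (W Y : g) : ⟪F.basis 3, L.adT Y W⟫_ℝ = 0 := by
  rw [inner_adT, F.inner_bracket]
  simp

variable {F} {r c : ℝ}

theorem exists_isRelative (hr : 0 < r) (hX : L.IsStationary (F.point r c)) :
    ∃ l, (F.params r l).IsRelative c := by
  have hX' : L.adT (F.point r c) (F.point r c) = 0 := hX
  have h0 := F.inner_adT_zero (F.point r c) (F.point r c)
  have h1 := F.inner_adT_one (F.point r c) (F.point r c)
  rw [hX', inner_zero_right] at h0 h1
  simp only [inner_zero_point, inner_one_point, inner_two_point, inner_three_point] at h0 h1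
  refine ⟨(r * F.a₂ + c * F.b₂) / r, ?_, ?_, ?_⟩ <;> simp only [params]
  · refine (mul_eq_zero.1 (?_ : r * _ = 0)).resolve_left hr.ne'
    linear_combination h1
  · refine (mul_eq_zero.1 (?_ : r * _ = 0)).resolve_left hr.ne'
    linear_combination -h0
  · field_simp
    ring

variable {l : ℝ}

theorem inner_three_eq {Y : ℝ → g} (hY : L.IsSolution Y) (s : ℝ) :
    ⟪F.basis 3, Y s⟫_ℝ = ⟪F.basis 3, Y 0⟫_ℝ := by
  refine eq_initial_of_hasDerivAt_zero (f := fun s => ⟪F.basis 3, Y s⟫_ℝ)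
    (fun s => (hasDerivAt_const s _).inner ℝ (hY s)) (fun s => ?_) s
  rw [inner_adT_three, inner_zero_left, add_zero]

theorem isOrbit (h : (F.params r l).IsRelative c) {Y : ℝ → g} (hY : L.IsSolution Y) :
    (F.params r l).IsOrbit (⟪F.basis 3, Y 0⟫_ℝ - c) (fun s => ⟪F.basis 0, Y s⟫_ℝ)
      (fun s => ⟪F.basis 1, Y s⟫_ℝ) (fun s => ⟪F.basis 2, Y s⟫_ℝ - r) := by
  have hd : ∀ i s, HasDerivAt (fun s => ⟪F.basis i, Y s⟫_ℝ) ⟪F.basis i, L.adT (Y s) (Y s)⟫_ℝ s :=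
    fun i s => ((hasDerivAt_const s _).inner ℝ (hY s)).congr_deriv (by simp)
  obtain ⟨h1, h2, h3⟩ := h
  simp only [params] at h1 h2 h3
  refine ⟨fun s => (hd 0 s).congr_deriv ?_, fun s => (hd 1 s).congr_deriv ?_,
    fun s => ((hd 2 s).sub_const r).congr_deriv ?_⟩
  · rw [inner_adT_zero, inner_three_eq hY s]
    simp only [params]
    linear_combination ⟪F.basis 2, Y s⟫_ℝ * h2 - ⟪F.basis 1, Y s⟫_ℝ * h3
  · rw [inner_adT_one, inner_three_eq hY s]
    simp only [params]
    linear_combination ⟪F.basis 0, Y s⟫_ℝ * h3 - ⟪F.basis 2, Y s⟫_ℝ * h1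
  · rw [inner_adT_two, inner_three_eq hY s]
    simp only [params]
    linear_combination ⟪F.basis 1, Y s⟫_ℝ * h1 - ⟪F.basis 0, Y s⟫_ℝ * h2

theorem hasStableOrbits (h : (F.params r l).IsRelative c) (hs : L.IsStable (F.point r c)) :
    (F.params r l).HasStableOrbits := by
  intro ε hε
  obtain ⟨δ, hδ, H⟩ := hs ε hε
  refine ⟨δ / 4, by positivity, fun η₁ η₂ η₃ t h₁ h₂ h₃ ht => ?_⟩
  set D : g := η₁ • F.basis 0 + η₂ • F.basis 1 + η₃ • F.basis 2 + t • F.basis 3 with hD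
  have hDn : ‖D‖ < δ := by
    have i1 := norm_add_le (η₁ • F.basis 0 + η₂ • F.basis 1 + η₃ • F.basis 2) (t • F.basis 3)
    have i2 := norm_add_le (η₁ • F.basis 0 + η₂ • F.basis 1) (η₃ • F.basis 2)
    have i3 := norm_add_le (η₁ • F.basis 0) (η₂ • F.basis 1)
    rw [norm_smul_basis] at i1 i2
    rw [norm_smul_basis, norm_smul_basis] at i3
    linarith
  obtain ⟨Y, hY0, hY⟩ := L.exists_isSolution (F.point r c + D)
  have ho := isOrbit h hY
  have h3 : ⟪F.basis 3, Y 0⟫_ℝ - c = t := by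
    rw [hY0, inner_add_right, inner_three_point]
    simp [hD, inner_add_right, inner_smul_right]
  rw [h3] at ho
  refine ⟨_, _, _, ho, ?_, ?_, ?_, fun s hs0 => ?_⟩
  · rw [hY0]
    simp [hD, inner_add_right, inner_smul_right]
  · rw [hY0]
    simp [hD, inner_add_right, inner_smul_right]
  · rw [hY0]
    simp [hD, inner_add_right, inner_smul_right]
  · have hn : ‖Y s - F.point r c‖ < ε := H Y hY (by simpa [hY0] using hDn) s hs0
    have hi := fun i => (F.abs_inner_basis_le i (Y s - F.point r c)).trans hn.le
    simp only [inner_sub_right] at hi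
    exact ⟨by simpa using hi 0, by simpa using hi 1, by simpa using hi 2⟩

theorem isStable_of_isolatedByIntegrals (h : (F.params r l).IsRelative c)
    (hP : (F.params r l).IsolatedByIntegrals) : L.IsStable (F.point r c) := by
  obtain ⟨ρ, hρ, H⟩ := hP
  let y : Fin 4 → g → ℝ := fun i Y => ⟪F.basis i, Y⟫_ℝ
  have hy : ∀ i, Continuous (y i) := fun i => by fun_prop
  let P := F.params r l
  let S : g → ℝ := fun Y => 2 * P.r * (y 2 Y - r) + y 0 Y ^ 2 + y 1 Y ^ 2 + (y 2 Y - r) ^ 2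
  let Q : g → ℝ := fun Y => P.m₁ * y 0 Y ^ 2 + P.m₂ * y 1 Y ^ 2 + P.q * (y 2 Y - r) ^ 2 +
    2 * (P.p₁ * (y 0 Y * (y 2 Y - r))) + 2 * (P.p₂ * (y 1 Y * (y 2 Y - r))) +
    2 * (y 3 Y - c) * (P.b₁ * y 0 Y + P.b₂ * y 1 Y + P.b₃ * (y 2 Y - r))
  refine isStable_of_firstIntegral L (V := fun Y => (y 3 Y - c) ^ 2 + S Y ^ 2 + Q Y ^ 2)
    (by fun_prop) (fun Y hY t => ?_) (by simp [S, Q, y]) hρ fun Y hne hYρ => ?_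
  · have ho := isOrbit h hY
    have h3 : y 3 (Y t) = y 3 (Y 0) := inner_three_eq hY t
    have hS : S (Y t) = S (Y 0) := ho.momentum_eq t
    have hQ : Q (Y t) = Q (Y 0) := by
      have := ho.energy_eq t
      simp only [Q, h3]
      exact this
    simp only [h3, hS, hQ]
  · refine lt_of_le_of_ne (by positivity) fun h0 => hne ?_
    have hi := fun i => (F.abs_inner_basis_le i (Y - F.point r c)).trans hYρ.le
    simp only [inner_sub_right] at hi
    have h3 : y 3 Y - c = 0 := (pow_eq_zero_iff two_ne_zero).1
      (le_antisymm (by linarith [sq_nonneg (y 3 Y - c), sq_nonneg (S Y), sq_nonneg (Q Y)]) (sq_nonneg _))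
    have hS : S Y = 0 := (pow_eq_zero_iff two_ne_zero).1
      (le_antisymm (by linarith [sq_nonneg (y 3 Y - c), sq_nonneg (S Y), sq_nonneg (Q Y)]) (sq_nonneg _))
    have hQ : Q Y = 0 := (pow_eq_zero_iff two_ne_zero).1
      (le_antisymm (by linarith [sq_nonneg (y 3 Y - c), sq_nonneg (S Y), sq_nonneg (Q Y)]) (sq_nonneg _))
    simp only [Q, h3, mul_zero, zero_mul, add_zero] at hQ
    obtain ⟨v0, v1, v2⟩ := H (y 0 Y) (y 1 Y) (y 2 Y - r) (by simpa using hi 0)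
      (by simpa using hi 1) (by simpa using hi 2) hS hQ
    refine F.basis.repr.injective (PiLp.ext fun i => ?_)
    rw [F.basis.repr_apply_apply, F.basis.repr_apply_apply]
    fin_cases i
    · simpa using v0
    · simpa using v1
    · simpa [sub_eq_zero] using v2
    · simpa [sub_eq_zero] using h3

end EulerFrame

end LieStructure
theorem Matrix.charpoly_coeff_two_of_last_row_zero (m : Matrix (Fin 4) (Fin 4) ℝ)
    (h : ∀ j, m 3 j = 0) (h0 : m 0 0 = 0) (h1 : m 1 1 = 0) (h2 : m 2 2 = 0) :
    m.charpoly.coeff 2 = -(m 0 1 * m 1 0 + m 0 2 * m 2 0 + m 1 2 * m 2 1) := by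
  have hp : m.charpoly = Polynomial.X ^ 4 +
      Polynomial.C (-(m 0 1 * m 1 0 + m 0 2 * m 2 0 + m 1 2 * m 2 1)) * Polynomial.X ^ 2 +
      Polynomial.C (-(m 0 1 * m 1 2 * m 2 0 + m 0 2 * m 1 0 * m 2 1)) * Polynomial.X := by
    rw [Matrix.charpoly, Matrix.det_succ_row _ 3]
    simp [Fin.sum_univ_four, Matrix.charmatrix_apply, h, Matrix.det_fin_three,
      Matrix.submatrix_apply, Fin.succAbove, h0, h1, h2]
    ring
  rw [hp]
  simp only [Polynomial.coeff_add, Polynomial.coeff_C_mul, Polynomial.coeff_X_pow,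
    Polynomial.coeff_X]
  norm_num

theorem LinearMap.finrank_range_eq_one {V : Type*} [AddCommGroup V] [Module ℝ V]
    {T : V →ₗ[ℝ] V} {w : V} (hT : ∀ Y, ∃ a : ℝ, T Y = a • w) (h : T ≠ 0) :
    Module.finrank ℝ (LinearMap.range T) = 1 := by
  choose φ hT using hT
  obtain ⟨v, hv⟩ : ∃ v, T v ≠ 0 := by
    by_contra! hcon
    exact h (LinearMap.ext hcon)
  rw [finrank_eq_one_iff']
  refine ⟨⟨T v, v, rfl⟩, fun h0 => hv (congrArg Subtype.val h0), ?_⟩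
  rintro ⟨-, Y, rfl⟩
  have hφ : φ v ≠ 0 := fun h0 => hv (by rw [hT, h0, zero_smul])
  refine ⟨φ Y / φ v, Subtype.ext ?_⟩
  change (φ Y / φ v) • T v = T Y
  rw [hT v, hT Y, smul_smul, div_mul_cancel₀ _ hφ]

theorem LinearMap.inner_mul_inner_eq_of_finrank_range_eq_one {V : Type*} [NormedAddCommGroup V]
    [InnerProductSpace ℝ V] {T : V →ₗ[ℝ] V} (h : Module.finrank ℝ (LinearMap.range T) = 1)
    (a b Y W : V) : ⟪a, T Y⟫_ℝ * ⟪b, T W⟫_ℝ = ⟪a, T W⟫_ℝ * ⟪b, T Y⟫_ℝ := by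
  obtain ⟨⟨u, hu⟩, -, H⟩ := finrank_eq_one_iff'.1 h
  obtain ⟨y, hy⟩ := H ⟨T Y, Y, rfl⟩
  obtain ⟨w, hw⟩ := H ⟨T W, W, rfl⟩
  have hy' : T Y = y • u := (congrArg Subtype.val hy).symm
  have hw' : T W = w • u := (congrArg Subtype.val hw).symm
  rw [hy', hw']
  simp only [inner_smul_right]
  ring

namespace LieStructure

variable {g : Type*} [NormedAddCommGroup g] [InnerProductSpace ℝ g] [FiniteDimensional ℝ g]
variable {L : LieStructure g}

namespace EulerFrame

variable (F : L.EulerFrame)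

theorem inner_zero_J (r c : ℝ) (Y : g) : ⟪F.basis 0, L.J (F.point r c) Y⟫_ℝ =
    (r * F.a₁ - (r * F.a₂ + c * F.b₂)) * ⟪F.basis 1, Y⟫_ℝ +
      (r * F.p₁ + (r * F.p₁ + c * F.b₁)) * ⟪F.basis 2, Y⟫_ℝ + r * F.b₁ * ⟪F.basis 3, Y⟫_ℝ := by
  change ⟪_, L.adT _ _ + L.adT _ _⟫_ℝ = _
  rw [inner_add_right, inner_adT_zero, inner_adT_zero]
  simp only [inner_zero_point, inner_one_point, inner_two_point, inner_three_point]
  ring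

theorem inner_one_J (r c : ℝ) (Y : g) : ⟪F.basis 1, L.J (F.point r c) Y⟫_ℝ =
    (-(r * F.a₀ - (r * F.a₂ + c * F.b₂))) * ⟪F.basis 0, Y⟫_ℝ -
      (r * F.p₀ + (r * F.p₀ + c * F.b₀)) * ⟪F.basis 2, Y⟫_ℝ - r * F.b₀ * ⟪F.basis 3, Y⟫_ℝ := by
  change ⟪_, L.adT _ _ + L.adT _ _⟫_ℝ = _
  rw [inner_add_right, inner_adT_one, inner_adT_one]
  simp only [inner_zero_point, inner_one_point, inner_two_point, inner_three_point]
  ring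

theorem inner_two_J (r c : ℝ) (Y : g) : ⟪F.basis 2, L.J (F.point r c) Y⟫_ℝ =
    (r * F.p₀ + c * F.b₀) * ⟪F.basis 1, Y⟫_ℝ - (r * F.p₁ + c * F.b₁) * ⟪F.basis 0, Y⟫_ℝ := by
  change ⟪_, L.adT _ _ + L.adT _ _⟫_ℝ = _
  rw [inner_add_right, inner_adT_two, inner_adT_two]
  simp only [inner_zero_point, inner_one_point, inner_two_point, inner_three_point]
  ring

theorem inner_three_J (r c : ℝ) (Y : g) : ⟪F.basis 3, L.J (F.point r c) Y⟫_ℝ = 0 := by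
  change ⟪_, L.adT _ _ + L.adT _ _⟫_ℝ = _
  rw [inner_add_right, inner_adT_three, inner_adT_three, add_zero]

theorem sigmaCoeff_two_J (r c : ℝ) : sigmaCoeff 2 (L.J (F.point r c)) =
    (r * F.a₀ - (r * F.a₂ + c * F.b₂)) * (r * F.a₁ - (r * F.a₂ + c * F.b₂)) +
      (r * F.p₀ + (r * F.p₀ + c * F.b₀)) * (r * F.p₀ + c * F.b₀) +
      (r * F.p₁ + (r * F.p₁ + c * F.b₁)) * (r * F.p₁ + c * F.b₁) := by
  have hm : ∀ i j, LinearMap.toMatrix F.basis.toBasis F.basis.toBasis (L.J (F.point r c)) i j =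
      ⟪F.basis i, L.J (F.point r c) (F.basis j)⟫_ℝ := fun i j => by
    rw [LinearMap.toMatrix_apply, F.basis.coe_toBasis, F.basis.coe_toBasis_repr_apply,
      F.basis.repr_apply_apply]
  rw [sigmaCoeff, Module.finrank_eq_card_basis F.basis.toBasis,
    ← LinearMap.charpoly_toMatrix _ F.basis.toBasis, Fintype.card_fin,
    Matrix.charpoly_coeff_two_of_last_row_zero]
  all_goals simp [hm, inner_zero_J, inner_one_J, inner_two_J, inner_three_J]
  ring

theorem trace_J_comp_J (r c ζ : ℝ) :
    LinearMap.trace ℝ g (L.J (F.point r c) ∘ₗ L.J (F.point 0 ζ)) =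
      ζ * (F.b₂ * (r * F.a₀ - (r * F.a₂ + c * F.b₂)) + F.b₂ * (r * F.a₁ - (r * F.a₂ + c * F.b₂)) -
        F.b₁ * (r * F.p₁ + 2 * (r * F.p₁ + c * F.b₁)) -
        F.b₀ * (r * F.p₀ + 2 * (r * F.p₀ + c * F.b₀))) := by
  rw [LinearMap.trace_eq_sum_inner _ F.basis]
  simp only [Fin.sum_univ_four, LinearMap.comp_apply, inner_zero_J, inner_one_J, inner_two_J,
    inner_three_J]
  simp
  ring

variable {F} {r c l : ℝ}

theorem J_params (h : (F.params r l).IsRelative c) (Y : g) :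
    L.J (F.point r c) Y =
      (r * ((F.a₁ - l) * ⟪F.basis 1, Y⟫_ℝ + F.p₁ * ⟪F.basis 2, Y⟫_ℝ +
        F.b₁ * ⟪F.basis 3, Y⟫_ℝ)) • F.basis 0 -
      (r * ((F.a₀ - l) * ⟪F.basis 0, Y⟫_ℝ + F.p₀ * ⟪F.basis 2, Y⟫_ℝ +
        F.b₀ * ⟪F.basis 3, Y⟫_ℝ)) • F.basis 1 := by
  obtain ⟨h1, h2, h3⟩ := h
  simp only [params] at h1 h2 h3
  have hl : r * F.a₂ + c * F.b₂ = r * l := by linear_combination h3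
  rw [← F.basis.sum_repr' (L.J (F.point r c) Y), Fin.sum_univ_four, inner_zero_J, inner_one_J,
    inner_two_J, inner_three_J, h1, h2, hl]
  module

theorem sigmaCoeff_two_params (h : (F.params r l).IsRelative c) :
    sigmaCoeff 2 (L.J (F.point r c)) = r ^ 2 * ((F.a₀ - l) * (F.a₁ - l)) := by
  obtain ⟨h1, h2, h3⟩ := h
  simp only [params] at h1 h2 h3
  have hl : r * F.a₂ + c * F.b₂ = r * l := by linear_combination h3
  rw [sigmaCoeff_two_J, h1, h2, hl]
  ring

theorem inner_mul_trace_params (h : (F.params r l).IsRelative c) (ζ : ℝ) :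
    ⟪F.point r c, F.point 0 ζ⟫_ℝ *
      LinearMap.trace ℝ g (L.J (F.point r c) ∘ₗ L.J (F.point 0 ζ)) =
      (ζ * r) ^ 2 * (F.p₀ ^ 2 + F.p₁ ^ 2 - (F.a₂ - l) * (F.a₀ - l + (F.a₁ - l))) := by
  have hi : ⟪F.point r c, F.point 0 ζ⟫_ℝ = c * ζ := by
    rw [point.eq_def F 0 ζ, zero_smul, zero_add, inner_smul_right, real_inner_comm,
      inner_three_point, mul_comm]
  obtain ⟨h1, h2, h3⟩ := h
  simp only [params] at h1 h2 h3
  have hl : r * F.a₂ + c * F.b₂ = r * l := by linear_combination h3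
  rw [hi, trace_J_comp_J, h1, h2, hl]
  linear_combination ζ ^ 2 * r * (F.a₀ - l + (F.a₁ - l)) * h3 - ζ ^ 2 * r * F.p₀ * h1 -
    ζ ^ 2 * r * F.p₁ * h2

/-- The three spectral conditions at a stationary point with nonzero transversal part. -/
theorem isStable_params_iff (hr : 0 < r) (h : (F.params r l).IsRelative c) {ζ : ℝ} (hζ : ζ ≠ 0) :
    L.IsStable (F.point r c) ↔
      (L.J (F.point r c) = 0 ∨ 0 < sigmaCoeff 2 (L.J (F.point r c)) ∨
        (Module.finrank ℝ ↥(LinearMap.range (L.J (F.point r c))) = 1 ∧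
          ⟪F.point r c, F.point 0 ζ⟫_ℝ *
            LinearMap.trace ℝ g (L.J (F.point r c) ∘ₗ L.J (F.point 0 ζ)) < 0)) := by
  have hJ := J_params h
  have hζr : 0 < (ζ * r) ^ 2 := by positivity
  rw [sigmaCoeff_two_params h, inner_mul_trace_params h]
  constructor
  · intro hs
    have ho := hasStableOrbits h hs
    have hm := ho.mul_nonneg hr
    rcases hm.lt_or_eq with hm | hm
    · exact Or.inr (Or.inl (mul_pos (by positivity) hm))
    by_cases hJ0 : L.J (F.point r c) = 0
    · exact Or.inl hJ0
    refine Or.inr (Or.inr ?_)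
    by_cases h0 : F.a₀ - l = 0 <;> by_cases h1 : F.a₁ - l = 0
    · obtain ⟨e1, e2, e3, e4⟩ := ho.trivial hr h h0 h1
      simp only [params] at e1 e2 e3 e4
      refine absurd (LinearMap.ext fun Y => ?_) hJ0
      rw [hJ, h0, h1, e1, e2, e3, e4, LinearMap.zero_apply]
      simp
    · obtain ⟨e1, e2, e3⟩ := ho.swap.planar hr h.swap h1 h0
      simp only [params, GyrostatParams.swap, neg_eq_zero] at e1 e2 e3
      refine ⟨LinearMap.finrank_range_eq_one (w := F.basis 0) (fun Y => ⟨r * ((F.a₁ - l) *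
        ⟪F.basis 1, Y⟫_ℝ + F.p₁ * ⟪F.basis 2, Y⟫_ℝ + F.b₁ * ⟪F.basis 3, Y⟫_ℝ), ?_⟩) hJ0,
        mul_neg_of_pos_of_neg hζr ?_⟩
      · rw [hJ, h0, e1, e2]
        simp
      · rw [h0, e1]
        linarith
    · obtain ⟨e1, e2, e3⟩ := ho.planar hr h h0 h1
      simp only [params] at e1 e2 e3
      refine ⟨LinearMap.finrank_range_eq_one (w := F.basis 1) (fun Y => ⟨-(r * ((F.a₀ - l) *
        ⟪F.basis 0, Y⟫_ℝ + F.p₀ * ⟪F.basis 2, Y⟫_ℝ + F.b₀ * ⟪F.basis 3, Y⟫_ℝ)), ?_⟩) hJ0,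
        mul_neg_of_pos_of_neg hζr ?_⟩
      · rw [hJ, h1, e1, e2]
        simp
      · rw [h1, e1]
        linarith
    · exact absurd hm.symm (mul_ne_zero h0 h1)
  · rintro (hJ0 | hσ | ⟨hrank, htr⟩)
    · exact isStable_of_J_eq_zero hJ0
    · exact isStable_of_isolatedByIntegrals h (GyrostatParams.isolatedByIntegrals_of_mul_pos hr
        (pos_of_mul_pos_right hσ (by positivity)))
    have htr' := neg_of_mul_neg_right htr hζr.le
    have hminor := LinearMap.inner_mul_inner_eq_of_finrank_range_eq_one hrank (F.basis 0) (F.basis 1)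
    have hr2 : r * r ≠ 0 := by positivity
    have k1 := hminor (F.basis 1) (F.basis 0)
    have k2 := hminor (F.basis 1) (F.basis 2)
    have k3 := hminor (F.basis 2) (F.basis 0)
    simp [hJ, inner_sub_right, inner_smul_right, hr.ne'] at k1 k2 k3
    by_cases h0 : F.a₀ - l = 0 <;> by_cases h1 : F.a₁ - l = 0
    · rw [h0, h1] at htr'
      nlinarith [sq_nonneg F.p₀, sq_nonneg F.p₁]
    · have e : F.p₀ = 0 := by tauto
      refine isStable_of_isolatedByIntegrals h (.of_swap
        (GyrostatParams.isolatedByIntegrals_of_planar h1 h0 (neg_eq_zero.2 e) ?_))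
      rw [h0, e] at htr'
      simp only [params, GyrostatParams.swap]
      linarith
    · have e : F.p₁ = 0 := by tauto
      refine isStable_of_isolatedByIntegrals h
        (GyrostatParams.isolatedByIntegrals_of_planar h0 h1 e ?_)
      rw [h1, e] at htr'
      simp only [params]
      linarith
    · tauto

theorem J_point_zero_eq_zero_or_sigmaCoeff_pos (c : ℝ) :
    L.J (F.point 0 c) = 0 ∨ 0 < sigmaCoeff 2 (L.J (F.point 0 c)) := by
  have hσ : sigmaCoeff 2 (L.J (F.point 0 c)) =
      (c * F.b₀) ^ 2 + (c * F.b₁) ^ 2 + (c * F.b₂) ^ 2 := by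
    rw [sigmaCoeff_two_J]
    ring
  by_cases h : c * F.b₀ = 0 ∧ c * F.b₁ = 0 ∧ c * F.b₂ = 0
  · obtain ⟨h0, h1, h2⟩ := h
    refine Or.inl (LinearMap.ext fun Y => ?_)
    rw [← F.basis.sum_repr' (L.J (F.point 0 c) Y), Fin.sum_univ_four, inner_zero_J, inner_one_J,
      inner_two_J, inner_three_J, h0, h1, h2]
    simp
  · right
    rw [hσ]
    by_cases h0 : c * F.b₀ = 0
    · by_cases h1 : c * F.b₁ = 0
      · have h2 : c * F.b₂ ≠ 0 := fun h2 => h ⟨h0, h1, h2⟩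
        positivity
      · positivity
    · positivity

end EulerFrame

end LieStructure
/-- Theorem 1.2 (A)(b): stability criterion in a 4-dimensional unimodular metric Lie
algebra with 1-dimensional centre. -/
theorem stability_iff_dim4_center_one    {g : Type*} [NormedAddCommGroup g] [InnerProductSpace ℝ g] [FiniteDimensional ℝ g]
    (L : LieStructure g) (hdim : Module.finrank ℝ g = 4)
    (huni : L.IsUnimodular) (hz : Module.finrank ℝ ↥L.center = 1)
    (Z : g) (hZmem : Z ∈ L.center) (hZne : Z ≠ 0)
    (X : g) (hX : L.IsStationary X) :
    L.IsStable X ↔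
      (L.J X = 0 ∨ 0 < sigmaCoeff 2 (L.J X) ∨
        (Module.finrank ℝ ↥(LinearMap.range (L.J X)) = 1 ∧
          ⟪X, Z⟫_ℝ * LinearMap.trace ℝ g (L.J X ∘ₗ L.J Z) < 0)) := by
  obtain ⟨F, r, c, ζ, hr, hζ, rfl, hZ⟩ := LieStructure.exists_eulerFrame hdim huni hZmem hZne X
  have hZ' : Z = F.point 0 ζ := by
    rw [hZ, LieStructure.EulerFrame.point, zero_smul, zero_add]
  change L.IsStationary (F.point r c) at hX
  change L.IsStable (F.point r c) ↔ (L.J (F.point r c) = 0 ∨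
    0 < sigmaCoeff 2 (L.J (F.point r c)) ∨
      (Module.finrank ℝ ↥(LinearMap.range (L.J (F.point r c))) = 1 ∧ ⟪F.point r c, Z⟫_ℝ *
        LinearMap.trace ℝ g (L.J (F.point r c) ∘ₗ L.J Z) < 0))
  rw [hZ']
  rcases hr.eq_or_lt with rfl | hr
  · exact iff_of_true
      (LieStructure.isStable_of_mem_center (F.point_zero_mem_center c))
      ((LieStructure.EulerFrame.J_point_zero_eq_zero_or_sigmaCoeff_pos c).imp_right Or.inl)
  · obtain ⟨l, hl⟩ := LieStructure.EulerFrame.exists_isRelative hr hX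
    exact LieStructure.EulerFrame.isStable_params_iff hr hl hζ
end

section
/- Every 4-dimensional unimodular real Lie algebra with trivial centre contains an abelian ideal of dimension 3. -/
open Module

section

variable {K V g : Type*} [Field K]

/-- If every functional vanishing at `a` vanishes at `x` or at `y`, then `x` or `y` is a multiple
of `a`. -/
lemma mem_span_or_mem_span_of_forall_dual [AddCommGroup V] [Module K V] {a x y : V}
    (h : ∀ f : V →ₗ[K] K, f a = 0 → f x * f y = 0) :
    x ∈ Submodule.span K {a} ∨ y ∈ Submodule.span K {a} := by
  by_contra! hxy
  obtain ⟨f, hfx, hf⟩ := Submodule.exists_le_ker_of_notMem hxy.1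
  obtain ⟨k, hky, hk⟩ := Submodule.exists_le_ker_of_notMem hxy.2
  have hfa : f a = 0 := hf (Submodule.mem_span_singleton_self a)
  have hka : k a = 0 := hk (Submodule.mem_span_singleton_self a)
  have hfy : f y = 0 := (mul_eq_zero.1 (h f hfa)).resolve_left hfx
  have hkx : k x = 0 := (mul_eq_zero.1 (h k hka)).resolve_right hky
  have := h (f + k) (by simp [hfa, hka])
  simp [hfy, hkx, hfx, hky] at this

/-- A `2 × 2` matrix of vectors whose determinant vanishes under every functional has linearly
dependent columns or linearly dependent rows. -/
lemma columns_or_rows_dependent_of_forall_dual [AddCommGroup V] [Module K V] {a b c d : V}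
    (h : ∀ f : V →ₗ[K] K, f a * f d = f b * f c) :
    (∃ s t : K, (s ≠ 0 ∨ t ≠ 0) ∧ s • a + t • b = 0 ∧ s • c + t • d = 0) ∨
      ∃ s t : K, (s ≠ 0 ∨ t ≠ 0) ∧ s • a + t • c = 0 ∧ s • b + t • d = 0 := by
  have eq_zero_or {x y : V} (hxy : ∀ f : V →ₗ[K] K, f x * f y = 0) : x = 0 ∨ y = 0 := by
    simpa using mem_span_or_mem_span_of_forall_dual (a := 0) fun f _ ↦ hxy f
  by_cases ha : a = 0
  · subst ha
    rcases eq_zero_or fun f ↦ (by simpa using (h f).symm) with rfl | rfl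
    · exact .inr ⟨1, 0, by simp⟩
    · exact .inl ⟨1, 0, by simp⟩
  · have key := mem_span_or_mem_span_of_forall_dual (a := a) (x := b) (y := c) fun f hf ↦ by
      rw [← h f, hf, zero_mul]
    simp only [Submodule.mem_span_singleton] at key
    rcases key with ⟨r, rfl⟩ | ⟨r, rfl⟩
    · have hd := (eq_zero_or (x := a) (y := d - r • c) fun f ↦ by
        have := h f
        simp only [map_sub, map_smul, smul_eq_mul] at this ⊢
        linear_combination this).resolve_left ha
      exact .inl ⟨-r, 1, by simp, by simp, by rw [← hd]; module⟩
    · have hd := (eq_zero_or (x := a) (y := d - r • b) fun f ↦ by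
        have := h f
        simp only [map_sub, map_smul, smul_eq_mul] at this ⊢
        linear_combination this).resolve_left ha
      exact .inr ⟨-r, 1, by simp, by simp, by rw [← hd]; module⟩

variable [LieRing g] [LieAlgebra K g]

/-- In a unimodular Lie algebra of dimension four the exterior product of two exact `2`-forms
vanishes. -/
lemma exact_wedge_exact_eq_zero (b : Basis (Fin 4) K g)
    (huni : ∀ X : g, LinearMap.trace K g (LieAlgebra.ad K g X) = 0) (f h : g →ₗ[K] K) :
    f ⁅b 0, b 1⁆ * h ⁅b 2, b 3⁆ - f ⁅b 0, b 2⁆ * h ⁅b 1, b 3⁆ + f ⁅b 0, b 3⁆ * h ⁅b 1, b 2⁆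
      + f ⁅b 1, b 2⁆ * h ⁅b 0, b 3⁆ - f ⁅b 1, b 3⁆ * h ⁅b 0, b 2⁆
      + f ⁅b 2, b 3⁆ * h ⁅b 0, b 1⁆ = 0 := by
  set c : Fin 4 → Fin 4 → Fin 4 → K := fun i j k ↦ b.repr ⁅b i, b j⁆ k with hc
  set B : Fin 4 → Fin 4 → K := fun i j ↦ h ⁅b i, b j⁆ with hB
  have expand (i j) : ⁅b i, b j⁆ = ∑ k, c i j k • b k := (b.sum_repr _).symm
  have hf (i j) : f ⁅b i, b j⁆ = ∑ k, c i j k * f (b k) := by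
    rw [expand]; simp
  have hh (i j k) : h ⁅⁅b i, b j⁆, b k⁆ = ∑ m, c i j m * B m k := by
    rw [expand, sum_lie]; simp [hB]
  have T (i) : ∑ k, c i k k = 0 := by
    have := huni (b i)
    rw [LinearMap.trace_eq_matrix_trace K b] at this
    simpa [Matrix.trace, LinearMap.toMatrix_apply] using this
  have J (i j k) : ∑ m, c i j m * B m k + ∑ m, c j k m * B m i + ∑ m, c k i m * B m j = 0 := by
    rw [← hh, ← hh, ← hh, ← map_add, ← map_add]
    have : ⁅⁅b i, b j⁆, b k⁆ + ⁅⁅b j, b k⁆, b i⁆ + ⁅⁅b k, b i⁆, b j⁆ = 0 := by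
      rw [← neg_eq_zero, ← lie_jacobi (b k) (b i) (b j), ← lie_skew (b k) ⁅b i, b j⁆,
        ← lie_skew (b i) ⁅b j, b k⁆, ← lie_skew (b j) ⁅b k, b i⁆]
      abel
    rw [this, map_zero]
  have cs (i j k) : c j i k = -c i j k := by
    simp only [hc]; rw [← lie_skew, map_neg, Finsupp.neg_apply]
  have Bs (i j) : B j i = -B i j := by
    simp only [hB]; rw [← lie_skew, map_neg]
  have cd (i k) : c i i k = 0 := by simp [hc]
  have Bd (i) : B i i = 0 := by simp [hB]
  have J0 := J 1 2 3
  have J1 := J 0 2 3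
  have J2 := J 0 1 3
  have J3 := J 0 1 2
  have T0 := T 0
  have T1 := T 1
  have T2 := T 2
  have T3 := T 3
  simp only [hf]
  simp only [Fin.sum_univ_four, cd, Bd, cs 0 1, cs 0 2, cs 0 3, cs 1 2, cs 1 3, cs 2 3,
    Bs 0 1, Bs 0 2, Bs 0 3, Bs 1 2, Bs 1 3, Bs 2 3] at J0 J1 J2 J3 T0 T1 T2 T3 ⊢
  change (_ * B 2 3 - _ * B 1 3 + _ * B 1 2 + _ * B 0 3 - _ * B 0 2 + _ * B 0 1) = 0
  linear_combination f (b 0) * J0 - f (b 1) * J1 + f (b 2) * J2 - f (b 3) * J3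
    + (f (b 1) * B 2 3 - f (b 2) * B 1 3 + f (b 3) * B 1 2) * T0
    - (f (b 0) * B 2 3 - f (b 2) * B 0 3 + f (b 3) * B 0 2) * T1
    + (f (b 0) * B 1 3 - f (b 1) * B 0 3 + f (b 3) * B 0 1) * T2
    - (f (b 0) * B 1 2 - f (b 1) * B 0 2 + f (b 2) * B 0 1) * T3

/-- In a unimodular Lie algebra, a commutative hyperplane is an ideal. -/
lemma lie_mem_ker_of_commutative_ker [Module.Finite K g]
    (huni : ∀ X : g, LinearMap.trace K g (LieAlgebra.ad K g X) = 0) {f : g →ₗ[K] K}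
    (hcomm : ∀ x, f x = 0 → ∀ y, f y = 0 → ⁅x, y⁆ = 0) (y : g) {x : g} (hx : f x = 0) :
    f ⁅y, x⁆ = 0 := by
  by_cases hf : f = 0
  · simp [hf]
  obtain ⟨w, hw⟩ : ∃ w, f w = 1 := LinearMap.surjective hf 1
  have had : LieAlgebra.ad K g x = f.smulRight ⁅x, w⁆ := by
    ext z
    have := hcomm x hx (z - f z • w) (by simp [hw])
    simpa [sub_eq_zero] using this
  have htr : f ⁅x, w⁆ = 0 := by
    have := huni x
    rwa [had, LinearMap.trace_smulRight] at this
  rw [← lie_skew, map_neg, neg_eq_zero, ← LieAlgebra.ad_apply K, had]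
  simp [htr]

/-- A nonzero bracket in a four-dimensional unimodular Lie algebra yields a basis adapted to the
exact `2`-form of a functional detecting that bracket: its last two vectors span the radical of the
form. They commute, and the remaining brackets form a matrix with zero determinant. -/
lemma exists_basis_lie_eq_zero [NeZero (2 : K)] [Module.Finite K g] (hdim : finrank K g = 4)
    (huni : ∀ X : g, LinearMap.trace K g (LieAlgebra.ad K g X) = 0)
    {u v : g} (huv : ⁅u, v⁆ ≠ 0) :
    ∃ b : Basis (Fin 4) K g, ⁅b 2, b 3⁆ = 0 ∧
      ∀ h : g →ₗ[K] K, h ⁅b 0, b 2⁆ * h ⁅b 1, b 3⁆ = h ⁅b 0, b 3⁆ * h ⁅b 1, b 2⁆ := by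
  obtain ⟨f, hf⟩ : ∃ f : g →ₗ[K] K, f ⁅u, v⁆ ≠ 0 := by
    by_contra! h
    exact huv ((Module.forall_dual_apply_eq_zero_iff K _).1 h)
  let φ : g →ₗ[K] K × K :=
    (f ∘ₗ (LieAlgebra.ad K g u : g →ₗ[K] g)).prod (f ∘ₗ (LieAlgebra.ad K g v : g →ₗ[K] g))
  have mem_ker (x : LinearMap.ker φ) : f ⁅u, (x : g)⁆ = 0 ∧ f ⁅v, (x : g)⁆ = 0 := by
    simpa [φ] using x.2
  have hker : 1 < finrank K (LinearMap.ker φ) := by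
    have h₁ := φ.finrank_range_add_finrank_ker
    have h₂ := (LinearMap.range φ).finrank_le
    rw [finrank_prod, finrank_self] at h₂
    omega
  have := nontrivial_of_finrank_pos (one_pos.trans hker)
  obtain ⟨x, hx⟩ := exists_ne (0 : LinearMap.ker φ)
  obtain ⟨y, hxy⟩ := exists_linearIndependent_pair_of_one_lt_finrank hker hx
  obtain ⟨hux, hvx⟩ := mem_ker x
  obtain ⟨huy, hvy⟩ := mem_ker y
  have hli : LinearIndependent K ![u, v, (x : g), (y : g)] := by
    rw [LinearIndependent.pair_iff] at hxy
    rw [Fintype.linearIndependent_iff]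
    intro c hc
    simp only [Fin.sum_univ_four, Matrix.cons_val] at hc
    have h1 : c 1 = 0 := by
      simpa [hux, huy, hf] using congrArg (fun z ↦ f ⁅u, z⁆) hc
    have h0 : c 0 = 0 := by
      have hvu : f ⁅v, u⁆ ≠ 0 := by rwa [← lie_skew, map_neg, neg_ne_zero]
      simpa [hvx, hvy, hvu] using congrArg (fun z ↦ f ⁅v, z⁆) hc
    obtain ⟨h2, h3⟩ := hxy (c 2) (c 3) (Subtype.ext (by simpa [h0, h1] using hc))
    intro i
    fin_cases i <;> assumption
  let b := basisOfLinearIndependentOfCardEqFinrank hli (by simp [hdim])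
  have hb0 : b 0 = u := by simp [b]
  have hb1 : b 1 = v := by simp [b]
  have hb2 : b 2 = x := by simp [b]
  have hb3 : b 3 = y := by simp [b]
  have hwedge := exact_wedge_exact_eq_zero b huni
  have hfxy : f ⁅(x : g), (y : g)⁆ = 0 := by
    have := hwedge f f
    simp only [hb0, hb1, hb2, hb3, hux, huy, hvx, hvy] at this
    have : (2 : K) * (f ⁅u, v⁆ * f ⁅(x : g), (y : g)⁆) = 0 := by linear_combination this
    simpa [hf, two_ne_zero] using this
  have h23 : ⁅b 2, b 3⁆ = 0 := by
    refine (Module.forall_dual_apply_eq_zero_iff K _).1 fun h ↦ ?_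
    simpa [hb0, hb1, hb2, hb3, hux, huy, hvx, hvy, hfxy, hf] using hwedge f h
  refine ⟨b, h23, fun h ↦ mul_left_cancel₀ (two_ne_zero (α := K)) ?_⟩
  have := hwedge h h
  rw [h23, h.map_zero] at this
  linear_combination -this

end

/-- Every 4-dimensional unimodular real Lie algebra with trivial centre contains a
3-dimensional abelian ideal. -/
theorem exists_abelian_ideal_of_unimodular_centerless
    {g : Type*} [LieRing g] [LieAlgebra ℝ g] [Module.Finite ℝ g]
    (hdim : Module.finrank ℝ g = 4)
    (huni : ∀ X : g, LinearMap.trace ℝ g (LieAlgebra.ad ℝ g X) = 0)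
    (hz : LieAlgebra.center ℝ g = ⊥) :
    ∃ a : LieIdeal ℝ g, (∀ x ∈ a, ∀ y ∈ a, ⁅x, y⁆ = 0) ∧ Module.finrank ℝ ↥a = 3 := by
  have center_eq_zero {x : g} (hx : ∀ y : g, ⁅y, x⁆ = 0) : x = 0 := by
    have : x ∈ LieAlgebra.center ℝ g := (LieModule.mem_maxTrivSubmodule ℝ g g x).2 hx
    rwa [hz, LieSubmodule.mem_bot] at this
  obtain ⟨u, v, huv⟩ : ∃ u v : g, ⁅u, v⁆ ≠ 0 := by
    by_contra! h
    have : Subsingleton g :=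
      subsingleton_of_forall_eq 0 fun x ↦ center_eq_zero fun y ↦ h y x
    rw [finrank_zero_of_subsingleton] at hdim
    omega
  obtain ⟨b, h23, hdet⟩ := exists_basis_lie_eq_zero hdim huni huv
  rcases columns_or_rows_dependent_of_forall_dual hdet with
    ⟨s, t, hst, h0, h1⟩ | ⟨s, t, hst, h2, h3⟩
  · have hw : s • b 2 + t • b 3 = 0 := center_eq_zero fun y ↦ by
      have h32 : ⁅b 3, b 2⁆ = 0 := by rw [← lie_skew, h23, neg_zero]
      have hb (i : Fin 4) : ⁅b i, s • b 2 + t • b 3⁆ = 0 := by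
        fin_cases i <;> simp [h23, h32, h0, h1]
      rw [← b.sum_repr y, sum_lie]
      simp only [smul_lie, hb, smul_zero, Finset.sum_const_zero]
    have hrepr := congrArg b.repr hw
    have hs := DFunLike.congr_fun hrepr 2
    have ht := DFunLike.congr_fun hrepr 3
    simp at hs ht
    simp [hs, ht] at hst
  · let f : g →ₗ[ℝ] ℝ := t • b.coord 0 - s • b.coord 1
    have hcomm (x : g) (hx : f x = 0) (y : g) (hy : f y = 0) : ⁅x, y⁆ = 0 := by
      have key (z : g) (hz : f z = 0) : ∃ k, b.repr z 0 = k * s ∧ b.repr z 1 = k * t := by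
        simp only [f, LinearMap.sub_apply, LinearMap.smul_apply, Basis.coord_apply,
          smul_eq_mul] at hz
        rcases hst with h | h
        · exact ⟨b.repr z 0 / s, by field_simp, by field_simp; linear_combination -hz⟩
        · exact ⟨b.repr z 1 / t, by field_simp; linear_combination hz, by field_simp⟩
      have expand (z : g) (hz : f z = 0) :
          ∃ k l m : ℝ, z = k • (s • b 0 + t • b 1) + l • b 2 + m • b 3 := by
        obtain ⟨k, h0, h1⟩ := key z hz
        refine ⟨k, b.repr z 2, b.repr z 3, ?_⟩
        conv_lhs => rw [← b.sum_repr z, Fin.sum_univ_four, h0, h1]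
        module
      have h2' : ⁅s • b 0 + t • b 1, b 2⁆ = 0 := by simpa using h2
      have h3' : ⁅s • b 0 + t • b 1, b 3⁆ = 0 := by simpa using h3
      obtain ⟨k, l, m, rfl⟩ := expand x hx
      obtain ⟨k', l', m', rfl⟩ := expand y hy
      generalize s • b 0 + t • b 1 = w at h2' h3'
      have h2s : ⁅b 2, w⁆ = 0 := by rw [← lie_skew, h2', neg_zero]
      have h3s : ⁅b 3, w⁆ = 0 := by rw [← lie_skew, h3', neg_zero]
      have h32 : ⁅b 3, b 2⁆ = 0 := by rw [← lie_skew, h23, neg_zero]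
      simp [h2', h3', h2s, h3s, h23, h32]
    have hf : f ≠ 0 := fun h ↦ by
      have hs := LinearMap.congr_fun h (b 1)
      have ht := LinearMap.congr_fun h (b 0)
      simp [f] at hs ht
      simp [hs, ht] at hst
    refine ⟨{ LinearMap.ker f with
      lie_mem := fun {y _} hx ↦ lie_mem_ker_of_commutative_ker huni hcomm y hx }, hcomm, ?_⟩
    have := f.finrank_range_add_finrank_ker
    rw [LinearMap.range_eq_top.2 (LinearMap.surjective hf), finrank_top, finrank_self, hdim] at this
    change finrank ℝ (LinearMap.ker f) = 3
    omega
end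

section
/- Let (g,⟨·,·⟩) be a unimodular metric Lie algebra with dim g = 4. Then the Euler equation has a nonzero stable stationary point. -/
open scoped InnerProductSpace

section InnerProducts

variable {g : Type*} [NormedAddCommGroup g] [InnerProductSpace ℝ g]

theorem eq_zero_or_eq_zero_of_forall_inner_mul_inner_eq_zero {q r : g}
    (h : ∀ Y : g, ⟪Y, q⟫_ℝ * ⟪Y, r⟫_ℝ = 0) : q = 0 ∨ r = 0 := by
  by_contra! hne
  have hq : 0 < ⟪q, q⟫_ℝ := real_inner_self_pos.2 hne.1
  have hr : 0 < ⟪r, r⟫_ℝ := real_inner_self_pos.2 hne.2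
  have h1 : ⟪q, r⟫_ℝ = 0 := (mul_eq_zero.1 (h q)).resolve_left hq.ne'
  have h2 := h (q + r)
  simp only [inner_add_left, h1, real_inner_comm q r, zero_add, add_zero] at h2
  have := mul_pos hq hr
  linarith

theorem exists_eq_smul_or_eq_smul_of_inner_mul_inner_eq {p q r s : g} (hp : p ≠ 0)
    (h : ∀ Y : g, ⟪Y, p⟫_ℝ * ⟪Y, s⟫_ℝ = ⟪Y, q⟫_ℝ * ⟪Y, r⟫_ℝ) :
    ∃ c : ℝ, q = c • p ∨ r = c • p := by
  have hpp : ⟪p, p⟫_ℝ ≠ 0 := (real_inner_self_pos.2 hp).ne'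
  have key : ∀ q Y : g, ⟪Y, q - (⟪p, q⟫_ℝ / ⟪p, p⟫_ℝ) • p⟫_ℝ =
      ⟪Y - (⟪Y, p⟫_ℝ / ⟪p, p⟫_ℝ) • p, q⟫_ℝ := by
    intro q Y
    simp only [inner_sub_right, inner_sub_left, inner_smul_right, real_inner_smul_left]
    ring
  have := eq_zero_or_eq_zero_of_forall_inner_mul_inner_eq_zero
    (q := q - (⟪p, q⟫_ℝ / ⟪p, p⟫_ℝ) • p) (r := r - (⟪p, r⟫_ℝ / ⟪p, p⟫_ℝ) • p) (fun Y ↦ by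
      rw [key, key, ← h]
      have : ⟪Y - (⟪Y, p⟫_ℝ / ⟪p, p⟫_ℝ) • p, p⟫_ℝ = 0 := by
        rw [inner_sub_left, real_inner_smul_left]; field_simp; ring
      rw [this, zero_mul])
  rcases this with h0 | h0
  · exact ⟨_, Or.inl (sub_eq_zero.1 h0)⟩
  · exact ⟨_, Or.inr (sub_eq_zero.1 h0)⟩

theorem exists_common_kernel_of_inner_mul_inner_eq {p q r s : g}
    (h : ∀ Y : g, ⟪Y, p⟫_ℝ * ⟪Y, s⟫_ℝ = ⟪Y, q⟫_ℝ * ⟪Y, r⟫_ℝ) :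
    ∃ a b : ℝ, (a ≠ 0 ∨ b ≠ 0) ∧ ((a • p + b • q = 0 ∧ a • r + b • s = 0) ∨
      (a • p + b • r = 0 ∧ a • q + b • s = 0)) := by
  by_cases hp : p = 0
  · subst hp
    rcases eq_zero_or_eq_zero_of_forall_inner_mul_inner_eq_zero (q := q) (r := r)
      (fun Y ↦ by rw [← h, inner_zero_right, zero_mul]) with h0 | h0
    · exact ⟨1, 0, Or.inl one_ne_zero, Or.inr (by simp [h0])⟩
    · exact ⟨1, 0, Or.inl one_ne_zero, Or.inl (by simp [h0])⟩
  · obtain ⟨c, hc | hc⟩ := exists_eq_smul_or_eq_smul_of_inner_mul_inner_eq hp h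
    · have : p = 0 ∨ s - c • r = 0 := eq_zero_or_eq_zero_of_forall_inner_mul_inner_eq_zero
        (fun Y ↦ by
          have := h Y
          simp only [hc, inner_sub_right, inner_smul_right] at this ⊢
          linear_combination this)
      have hs := sub_eq_zero.1 (this.resolve_left hp)
      exact ⟨c, -1, by simp, Or.inl (by simp [hc, hs])⟩
    · have : p = 0 ∨ s - c • q = 0 := eq_zero_or_eq_zero_of_forall_inner_mul_inner_eq_zero
        (fun Y ↦ by
          have := h Y
          simp only [hc, inner_sub_right, inner_smul_right] at this ⊢
          linear_combination this)
      have hs := sub_eq_zero.1 (this.resolve_left hp)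
      exact ⟨c, -1, by simp, Or.inr (by simp [hc, hs])⟩

end InnerProducts

namespace LieStructure

variable {g : Type*} [NormedAddCommGroup g] [InnerProductSpace ℝ g]

theorem bracket_antisymm (L : LieStructure g) (x y : g) : L.bracket x y = -L.bracket y x := by
  have h := L.bracket_self (x + y)
  simp only [map_add, LinearMap.add_apply, L.bracket_self, zero_add, add_zero] at h
  exact eq_neg_of_add_eq_zero_right h

variable [FiniteDimensional ℝ g]

theorem inner_adT_left (L : LieStructure g) (X Y Z : g) :
    ⟪L.adT X Y, Z⟫_ℝ = ⟪Y, L.bracket X Z⟫_ℝ :=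
  LinearMap.adjoint_inner_left _ _ _

theorem trace_adT (L : LieStructure g) (X : g) :
    LinearMap.trace ℝ g (L.adT X) = LinearMap.trace ℝ g (L.ad X) := by
  let b := stdOrthonormalBasis ℝ g
  rw [LinearMap.trace_eq_sum_inner _ b, LinearMap.trace_eq_sum_inner _ b]
  refine Finset.sum_congr rfl fun i _ ↦ ?_
  rw [real_inner_comm, inner_adT_left]
  rfl

/-- The Kirillov form `⟨Y, [·, ·]⟩` of a unimodular metric Lie algebra is degenerate. -/
theorem IsUnimodular.exists_ne_zero_inner_bracket_eq_zero [Nontrivial g] {L : LieStructure g}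
    (hL : L.IsUnimodular) (Y : g) : ∃ z ≠ 0, ∀ W, ⟪Y, L.bracket z W⟫_ℝ = 0 := by
  by_contra! hne
  let Ω : g →ₗ[ℝ] g :=
    { toFun := fun Z ↦ L.adT Z Y
      map_add' := fun a b ↦ by simp [adT, ad]
      map_smul' := fun c a ↦ by simp [adT, ad] }
  have hΩ : ∀ Z W, ⟪Ω Z, W⟫_ℝ = ⟪Y, L.bracket Z W⟫_ℝ := fun Z W ↦ L.inner_adT_left Z Y W
  have hinj : Function.Injective Ω := by
    rw [injective_iff_map_eq_zero]
    intro z hz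
    by_contra h0
    obtain ⟨W, hW⟩ := hne z h0
    exact hW (by rw [← hΩ, hz, inner_zero_left])
  let e := LinearEquiv.ofInjectiveEndo Ω hinj
  obtain ⟨Z, hZ⟩ := (LinearMap.injective_iff_surjective.1 hinj) Y
  have hconj : e.conj (L.ad Z) = LinearMap.id - L.adT Z := by
    ext U
    obtain ⟨V, rfl⟩ := e.surjective U
    refine ext_inner_right ℝ fun W ↦ ?_
    have h1 : ∀ A, e A = Ω A := fun A ↦ rfl
    have hY : ⟪Y, L.bracket Z (L.bracket V W)⟫_ℝ = ⟪Y, L.bracket V W⟫_ℝ := by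
      rw [← hΩ, hZ]
    have hjac := congrArg (fun x ↦ ⟪Y, x⟫_ℝ) (L.jacobi Z V W)
    simp only [inner_add_right, inner_zero_right] at hjac
    rw [L.bracket_antisymm W (L.bracket Z V), L.bracket_antisymm W Z, map_neg, inner_neg_right,
      inner_neg_right] at hjac
    have hsymm : e.symm (Ω V) = V := e.symm_apply_apply V
    simp only [LinearEquiv.conj_apply, LinearMap.comp_apply, LinearEquiv.coe_coe, hsymm,
      LinearMap.sub_apply, LinearMap.id_apply, h1, inner_sub_left,
      inner_adT_left, hΩ]
    simp only [ad]
    linarith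
  have htr := LinearMap.trace_conj' (L.ad Z) e
  rw [hconj, map_sub, trace_adT, hL Z, sub_zero, LinearMap.trace_id] at htr
  exact Module.finrank_pos.ne' (Nat.cast_eq_zero.1 htr)

/-- The Pfaffian of the Kirillov form of a four-dimensional unimodular metric Lie algebra
vanishes. -/
theorem IsUnimodular.pfaffian_eq_zero {L : LieStructure g} (hL : L.IsUnimodular)
    (f : Module.Basis (Fin 4) ℝ g) (Y : g) :
    ⟪Y, L.bracket (f 0) (f 1)⟫_ℝ * ⟪Y, L.bracket (f 2) (f 3)⟫_ℝ
      - ⟪Y, L.bracket (f 0) (f 2)⟫_ℝ * ⟪Y, L.bracket (f 1) (f 3)⟫_ℝ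
      + ⟪Y, L.bracket (f 0) (f 3)⟫_ℝ * ⟪Y, L.bracket (f 1) (f 2)⟫_ℝ = 0 := by
  have : Nontrivial g := ⟨f 0, f 1, fun h ↦ by simpa using f.injective h⟩
  obtain ⟨z, hz, h⟩ := hL.exists_ne_zero_inner_bracket_eq_zero Y
  have hlin : ∀ j, ∑ i, f.repr z i * ⟪Y, L.bracket (f i) (f j)⟫_ℝ = 0 := by
    intro j
    rw [← h (f j)]
    conv_rhs => rw [← f.sum_repr z]
    simp only [map_sum, map_smul, LinearMap.sum_apply, LinearMap.smul_apply, inner_sum,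
      inner_smul_right]
  have h0 := hlin 0
  have h1 := hlin 1
  have h2 := hlin 2
  have h3 := hlin 3
  simp only [Fin.sum_univ_four, L.bracket_self, inner_zero_right, mul_zero, zero_add, add_zero,
    L.bracket_antisymm (f 1) (f 0), L.bracket_antisymm (f 2) (f 0), L.bracket_antisymm (f 3) (f 0),
    L.bracket_antisymm (f 2) (f 1), L.bracket_antisymm (f 3) (f 1), L.bracket_antisymm (f 3) (f 2),
    inner_neg_right, mul_neg] at h0 h1 h2 h3
  set a := ⟪Y, L.bracket (f 0) (f 1)⟫_ℝ
  set b := ⟪Y, L.bracket (f 0) (f 2)⟫_ℝ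
  set c := ⟪Y, L.bracket (f 0) (f 3)⟫_ℝ
  set d := ⟪Y, L.bracket (f 1) (f 2)⟫_ℝ
  set e := ⟪Y, L.bracket (f 1) (f 3)⟫_ℝ
  set k := ⟪Y, L.bracket (f 2) (f 3)⟫_ℝ
  by_contra hP
  refine hz (f.ext_elem fun i ↦ ?_)
  rw [map_zero, Finsupp.zero_apply]
  refine (mul_eq_zero.1 ?_).resolve_left hP
  fin_cases i <;> simp only [Fin.zero_eta, Fin.mk_one, Fin.reduceFinMk]
  · linear_combination k * h1 - e * h2 + d * h3
  · linear_combination -k * h0 + c * h2 - b * h3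
  · linear_combination e * h0 - c * h1 + a * h3
  · linear_combination -d * h0 + b * h1 - a * h2

/-- A unimodular four-dimensional metric Lie algebra has nontrivial centre or an abelian
subalgebra of codimension one. -/
theorem IsUnimodular.exists_central_or_exists_abelian {L : LieStructure g} (hL : L.IsUnimodular)
    (hdim : Module.finrank ℝ g = 4) :
    (∃ z ≠ 0, ∀ W, L.bracket z W = 0) ∨
      ∃ n : Submodule ℝ g, Module.finrank ℝ n = 3 ∧ ∀ x ∈ n, ∀ y ∈ n, L.bracket x y = 0 := by
  have : Nontrivial g := Module.nontrivial_of_finrank_pos (R := ℝ) (by omega)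
  by_cases hab : ∀ x y, L.bracket x y = 0
  · obtain ⟨z, hz⟩ := exists_ne (0 : g)
    exact Or.inl ⟨z, hz, hab z⟩
  push Not at hab
  obtain ⟨x, y, hxy⟩ := hab
  set Y₁ := L.bracket x y
  have hω : ⟪Y₁, L.bracket x y⟫_ℝ ≠ 0 := (real_inner_self_pos.2 hxy).ne'
  let φ : g →ₗ[ℝ] ℝ × ℝ :=
    ((innerₗ g Y₁).comp (L.bracket x)).prod ((innerₗ g Y₁).comp (L.bracket y))
  have hker : 2 ≤ Module.finrank ℝ (LinearMap.ker φ) := by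
    have h1 := φ.finrank_range_add_finrank_ker
    have h2 := (LinearMap.range φ).finrank_le
    simp only [Module.finrank_prod, Module.finrank_self] at h2
    omega
  obtain ⟨w, hw⟩ := exists_linearIndependent_of_le_finrank hker
  have hwx : ∀ i, ⟪Y₁, L.bracket x (w i)⟫_ℝ = 0 := fun i ↦
    congrArg Prod.fst (LinearMap.mem_ker.1 (w i).2)
  have hwy : ∀ i, ⟪Y₁, L.bracket y (w i)⟫_ℝ = 0 := fun i ↦
    congrArg Prod.snd (LinearMap.mem_ker.1 (w i).2)
  have hindep : ∀ a b c d : ℝ, a • x + b • y + c • (w 0 : g) + d • (w 1 : g) = 0 →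
      a = 0 ∧ b = 0 ∧ c = 0 ∧ d = 0 := by
    intro a b c d h
    have hb := congrArg (fun v ↦ ⟪Y₁, L.bracket x v⟫_ℝ) h
    have ha := congrArg (fun v ↦ ⟪Y₁, L.bracket y v⟫_ℝ) h
    simp only [map_add, map_smul, inner_add_right, inner_smul_right, hwx, hwy, L.bracket_self,
      L.bracket_antisymm y x, inner_neg_right, inner_zero_right, map_zero, mul_zero, add_zero,
      zero_add, mul_neg, neg_eq_zero, mul_eq_zero, hω, or_false] at ha hb
    subst ha hb
    have h' : c • w 0 + d • w 1 = 0 := by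
      ext
      simpa using h
    have := Fintype.linearIndependent_iff.1 hw ![c, d] (by simpa using h')
    exact ⟨rfl, rfl, this 0, this 1⟩
  have hli : LinearIndependent ℝ ![x, y, (w 0 : g), (w 1 : g)] := by
    rw [Fintype.linearIndependent_iff]
    intro c hc i
    simp only [Fin.sum_univ_four, Matrix.cons_val] at hc
    obtain ⟨h0, h1, h2, h3⟩ := hindep _ _ _ _ hc
    fin_cases i <;> assumption
  let f := basisOfLinearIndependentOfCardEqFinrank hli (by simp [hdim])
  have hf : ⇑f = ![x, y, (w 0 : g), (w 1 : g)] :=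
    coe_basisOfLinearIndependentOfCardEqFinrank _ _
  have hpf := hL.pfaffian_eq_zero f
  simp only [hf, Matrix.cons_val] at hpf
  have h1 : ⟪Y₁, L.bracket (w 0 : g) (w 1 : g)⟫_ℝ = 0 := by
    have := hpf Y₁
    rw [hwx, hwx] at this
    simpa [hω] using this
  have hww : L.bracket (w 0 : g) (w 1 : g) = 0 := by
    refine ext_inner_left ℝ fun Y ↦ ?_
    have h2 := hpf (Y₁ + Y)
    have h3 := hpf Y
    simp only [inner_add_left, hwx, hwy, h1, zero_add] at h2
    rw [inner_zero_right]
    refine (mul_eq_zero.1 ?_).resolve_left hω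
    linear_combination h2 - h3
  obtain ⟨a, b, hne, h⟩ := exists_common_kernel_of_inner_mul_inner_eq
    (p := L.bracket x (w 0)) (q := L.bracket x (w 1))
    (r := L.bracket y (w 0)) (s := L.bracket y (w 1)) (fun Y ↦ by
      have := hpf Y
      rw [hww, inner_zero_right] at this
      linear_combination -this)
  rcases h with ⟨hx, hy⟩ | ⟨h0, h1⟩
  · left
    refine ⟨a • (w 0 : g) + b • (w 1 : g), fun h0 ↦ ?_, fun W ↦ ?_⟩
    · have := hindep 0 0 a b (by simpa using h0)
      rcases hne with hne | hne
      · exact hne this.2.2.1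
      · exact hne this.2.2.2
    · have hflip : L.bracket.flip (a • (w 0 : g) + b • (w 1 : g)) = 0 := f.ext fun i ↦ by
        fin_cases i <;>
          simp [hf, hx, hy, hww, L.bracket_self, L.bracket_antisymm (w 1) (w 0)]
      rw [L.bracket_antisymm, neg_eq_zero]
      exact LinearMap.congr_fun hflip W
  · right
    set u := a • x + b • y with hu
    have hu0 : L.bracket u (w 0) = 0 := by simpa [hu] using h0
    have hu1 : L.bracket u (w 1) = 0 := by simpa [hu] using h1
    have hli3 : LinearIndependent ℝ ![u, (w 0 : g), (w 1 : g)] := by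
      rw [Fintype.linearIndependent_iff]
      intro c hc i
      simp only [Fin.sum_univ_three, Matrix.cons_val] at hc
      obtain ⟨h0, h1, h2, h3⟩ := hindep (c 0 * a) (c 0 * b) (c 1) (c 2)
        (by rw [← hc, hu, smul_add, mul_smul, mul_smul])
      fin_cases i
      · rcases hne with hne | hne
        · exact (mul_eq_zero.1 h0).resolve_right hne
        · exact (mul_eq_zero.1 h1).resolve_right hne
      · exact h2
      · exact h3
    refine ⟨Submodule.span ℝ (Set.range ![u, (w 0 : g), (w 1 : g)]), ?_, ?_⟩
    · rw [finrank_span_eq_card hli3, Fintype.card_fin]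
    · have hgen : ∀ i j, L.bracket (![u, (w 0 : g), (w 1 : g)] i)
          (![u, (w 0 : g), (w 1 : g)] j) = 0 := by
        intro i j
        fin_cases i <;> fin_cases j <;>
          simp [L.bracket_self, hu0, hu1, hww, L.bracket_antisymm (w 0) u,
            L.bracket_antisymm (w 1) u, L.bracket_antisymm (w 1) (w 0)]
      intro p hp q hq
      induction hp, hq using Submodule.span_induction₂ with
      | mem_mem p q hp hq =>
        obtain ⟨i, rfl⟩ := hp
        obtain ⟨j, rfl⟩ := hq
        exact hgen i j
      | zero_left => simp
      | zero_right => simp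
      | add_left p q r _ _ _ h1 h2 => simp [h1, h2]
      | add_right p q r _ _ _ h1 h2 => simp [h1, h2]
      | smul_left c p q _ _ h => simp [h]
      | smul_right c p q _ _ h => simp [h]

/-- A vector whose adjoint action preserves the energy is a stable stationary point. -/
theorem isStationary_and_isStable_of_inner_bracket_eq_zero {L : LieStructure g} {z : g}
    (hz : ∀ Y, ⟪Y, L.bracket z Y⟫_ℝ = 0) : L.IsStationary z ∧ L.IsStable z := by
  constructor
  · refine ext_inner_right ℝ fun W ↦ ?_
    have h := hz (z + W)
    have hW := hz W
    simp only [map_add, L.bracket_self, zero_add, inner_add_left, hW, add_zero] at h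
    rw [inner_adT_left, h, inner_zero_left]
  · have key : ∀ Y, L.IsSolution Y → ∀ t, ‖Y t - z‖ ^ 2 = ‖Y 0 - z‖ ^ 2 := by
      intro Y hY t
      have hd : ∀ t, HasDerivAt (fun t ↦ ‖Y t - z‖ ^ 2) 0 t := by
        intro t
        refine (((hY t).sub_const z).norm_sq).congr_deriv ?_
        rw [real_inner_comm, inner_adT_left, map_sub, L.bracket_self, zero_sub,
          L.bracket_antisymm, neg_neg, hz, mul_zero]
      exact is_const_of_deriv_eq_zero (fun t ↦ (hd t).differentiableAt)
        (fun t ↦ (hd t).deriv) t 0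
    intro ε hε
    refine ⟨ε, hε, fun Y hY h0 t _ ↦ ?_⟩
    rw [(sq_eq_sq₀ (norm_nonneg _) (norm_nonneg _)).1 (key Y hY t)]
    exact h0

end LieStructure

section LinearFlow

open NormedSpace Topology

theorem add_mul_add_sq_le_of_le_deriv2 {f f' f'' : ℝ → ℝ} (hf : ∀ s, HasDerivAt f (f' s) s)
    (hf' : ∀ s, HasDerivAt f' (f'' s) s) {c σ : ℝ} (hσ : 0 < σ)
    (hc : ∀ s, |s| ≤ σ → 2 * c ≤ f'' s) {s : ℝ} (hs : |s| ≤ σ) :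
    f 0 + f' 0 * s + c * s ^ 2 ≤ f s := by
  let h : ℝ → ℝ := fun s ↦ f s - f' 0 * s - c * s ^ 2
  have hd : ∀ s, HasDerivAt h (f' s - f' 0 - 2 * c * s) s := fun s ↦
    (((hf s).sub ((hasDerivAt_id s).const_mul (f' 0))).sub
      (((hasDerivAt_id s).pow 2).const_mul c)).congr_deriv (by simp; ring)
  have hd' : ∀ s, HasDerivAt (fun s ↦ f' s - f' 0 - 2 * c * s) (f'' s - 2 * c) s := fun s ↦
    (((hf' s).sub_const (f' 0)).sub ((hasDerivAt_id s).const_mul (2 * c))).congr_deriv (by simp)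
  have hconv : ConvexOn ℝ (Set.Icc (-σ) σ) h := by
    refine convexOn_of_hasDerivWithinAt2_nonneg (convex_Icc _ _)
      (fun x _ ↦ (hd x).continuousAt.continuousWithinAt)
      (fun x _ ↦ (hd x).hasDerivWithinAt) (fun x _ ↦ (hd' x).hasDerivWithinAt) fun x hx ↦ ?_
    have := hc x (abs_le.2 (Set.mem_Icc.1 (interior_subset hx)))
    linarith
  have hmin : IsMinOn h (Set.Icc (-σ) σ) 0 := by
    refine hconv.isMinOn_of_rightDeriv_eq_zero ?_ ?_
    · rw [interior_Icc]
      exact ⟨by linarith, hσ⟩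
    · rw [(hd 0).hasDerivWithinAt.derivWithin (uniqueDiffWithinAt_Ioi 0)]
      ring
  have := hmin (abs_le.1 hs)
  simp only [Set.mem_ofPred_eq, h] at this
  linarith

variable {g : Type*} [NormedAddCommGroup g] [InnerProductSpace ℝ g] [CompleteSpace g]

theorem hasDerivAt_exp_smul_apply (B : g →L[ℝ] g) (v : g) (s : ℝ) :
    HasDerivAt (fun s : ℝ ↦ exp (s • B) v) (B (exp (s • B) v)) s := by
  have := (hasDerivAt_exp_smul_const' B s).clm_apply (hasDerivAt_const s v)
  simpa using this

/-- A curve moving along the orbits of the linear flow of `B`, with speed `y`, is a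
reparametrisation of an orbit. -/
theorem eq_exp_smul_apply_of_hasDerivAt {B : g →L[ℝ] g} {y s : ℝ → ℝ} {v : ℝ → g}
    (hs : ∀ t, HasDerivAt s (y t) t) (hs0 : s 0 = 0)
    (hv : ∀ t, HasDerivAt v (y t • B (v t)) t) (t : ℝ) :
    v t = exp (s t • B) (v 0) := by
  have hd : ∀ t, HasDerivAt (fun t ↦ exp ((-s t) • B) (v t)) 0 t := by
    intro t
    have h1 := (hasDerivAt_exp_smul_const B (-s t)).scomp t (hs t).neg
    refine (h1.clm_apply (hv t)).congr_deriv ?_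
    simp
  have hconst := is_const_of_deriv_eq_zero (fun t ↦ (hd t).differentiableAt)
    (fun t ↦ (hd t).deriv) t 0
  simp only [hs0, neg_zero, zero_smul, exp_zero, one_apply_eq_self] at hconst
  have := NormedAlgebra.restrictScalars ℚ ℝ (g →L[ℝ] g)
  rw [← hconst, ← mul_apply_eq_comp, ← exp_add_of_commute, ← add_smul]
  · simp
  · exact ((Commute.refl B).smul_left _).smul_right _

/-- Stability of the equilibrium `(0, x)` of the system `y' = -⟨v, B v⟩`, `v' = y B v` when
`s ↦ ‖exp (s B) x‖²` has a nondegenerate local minimum at `0`. -/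
theorem exists_stability_radius {B : g →L[ℝ] g} {x : g} (hx : ⟪x, B x⟫_ℝ = 0)
    (hpos : 0 < ⟪B x, B x⟫_ℝ + ⟪x, B (B x)⟫_ℝ) {ε : ℝ} (hε : 0 < ε) :
    ∃ δ > 0, ∀ (y : ℝ → ℝ) (v : ℝ → g), (∀ t, HasDerivAt v (y t • B (v t)) t) →
      (∀ t, HasDerivAt y (-⟪v t, B (v t)⟫_ℝ) t) → |y 0| < δ → ‖v 0 - x‖ < δ →
      ∀ t, |y t| < ε ∧ ‖v t - x‖ < ε := by
  set c := (⟪B x, B x⟫_ℝ + ⟪x, B (B x)⟫_ℝ) / 2 with hc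
  have hc0 : 0 < c := by positivity
  have hcont : Continuous fun p : ℝ × g ↦ exp (p.1 • B) p.2 := by
    have := NormedAlgebra.restrictScalars ℚ ℝ (g →L[ℝ] g)
    have : Continuous fun p : ℝ × g ↦ exp (p.1 • B) :=
      exp_continuous.comp (continuous_fst.smul continuous_const)
    exact this.clm_apply continuous_snd
  have hG : Continuous fun w : g ↦ ⟪B w, B w⟫_ℝ + ⟪w, B (B w)⟫_ℝ := by fun_prop
  have hzero : exp ((0 : ℝ) • B) x = x := by simp
  have hev : ∀ᶠ p in 𝓝 ((0 : ℝ), x), ‖exp (p.1 • B) p.2 - x‖ < ε ∧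
      c < ⟪B (exp (p.1 • B) p.2), B (exp (p.1 • B) p.2)⟫_ℝ +
        ⟪exp (p.1 • B) p.2, B (B (exp (p.1 • B) p.2))⟫_ℝ := by
    refine Filter.Eventually.and ?_ ?_
    · refine (hcont.sub continuous_const).norm.continuousAt.eventually_lt continuousAt_const ?_
      simpa [hzero] using hε
    · refine continuousAt_const.eventually_lt (hG.comp hcont).continuousAt ?_
      simp only [hzero]
      linarith
  obtain ⟨r, hr, hball⟩ := Metric.eventually_nhds_iff.1 hev
  set σ := r / 2 with hσ
  have hσ0 : 0 < σ := by positivity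
  have hnear : ∀ s v₀, |s| ≤ σ → ‖v₀ - x‖ < r → ‖exp (s • B) v₀ - x‖ < ε ∧
      c < ⟪B (exp (s • B) v₀), B (exp (s • B) v₀)⟫_ℝ +
        ⟪exp (s • B) v₀, B (B (exp (s • B) v₀))⟫_ℝ := by
    intro s v₀ hs hv
    refine hball (y := (s, v₀)) ?_
    rw [Prod.dist_eq, max_lt_iff, Real.dist_eq, dist_eq_norm, sub_zero]
    exact ⟨by linarith, hv⟩
  have hev2 : ∀ᶠ p in 𝓝 ((0 : ℝ), x),
      p.1 ^ 2 + 2 * |⟪p.2, B p.2⟫_ℝ| * σ < min (c * σ ^ 2) (ε ^ 2) := by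
    refine ContinuousAt.eventually_lt (by fun_prop) continuousAt_const ?_
    simp only [hx, abs_zero]
    rw [zero_pow two_ne_zero, mul_zero, zero_mul, add_zero]
    positivity
  obtain ⟨r', hr', hball'⟩ := Metric.eventually_nhds_iff.1 hev2
  refine ⟨min r r', lt_min hr hr', fun y v hv hy hy0 hv0 ↦ ?_⟩
  have hsmall : y 0 ^ 2 + 2 * |⟪v 0, B (v 0)⟫_ℝ| * σ < min (c * σ ^ 2) (ε ^ 2) := by
    refine hball' (y := (y 0, v 0)) ?_
    rw [Prod.dist_eq, max_lt_iff, Real.dist_eq, dist_eq_norm, sub_zero]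
    exact ⟨hy0.trans_le (min_le_right _ _), hv0.trans_le (min_le_right _ _)⟩
  have hv_near : ‖v 0 - x‖ < r := hv0.trans_le (min_le_left _ _)
  have hycont : Continuous y := continuous_iff_continuousAt.2 fun t ↦ (hy t).continuousAt
  set s : ℝ → ℝ := fun t ↦ ∫ τ in (0 : ℝ)..t, y τ with hs
  have hsd : ∀ t, HasDerivAt s (y t) t := fun t ↦ hycont.integral_hasStrictDerivAt 0 t |>.hasDerivAt
  have hs0 : s 0 = 0 := by simp [hs]
  have hvs := eq_exp_smul_apply_of_hasDerivAt hsd hs0 hv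
  have henergy : ∀ t, y t ^ 2 + ‖v t‖ ^ 2 = y 0 ^ 2 + ‖v 0‖ ^ 2 := by
    intro t
    have hd : ∀ t, HasDerivAt (fun t ↦ y t ^ 2 + ‖v t‖ ^ 2) 0 t := fun t ↦
      (((hy t).pow 2).add (hv t).norm_sq).congr_deriv (by
        rw [inner_smul_right]; push_cast; ring)
    exact is_const_of_deriv_eq_zero (fun t ↦ (hd t).differentiableAt)
      (fun t ↦ (hd t).deriv) t 0
  have hlower : ∀ a, |a| ≤ σ → ‖v 0‖ ^ 2 + 2 * ⟪v 0, B (v 0)⟫_ℝ * a + c * a ^ 2 ≤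
      ‖exp (a • B) (v 0)‖ ^ 2 := by
    intro a ha
    have h1 := fun a ↦ hasDerivAt_exp_smul_apply B (v 0) a
    have h2 := fun a ↦ (h1 a).norm_sq
    have h3 := fun a ↦ (((h1 a).inner ℝ (B.hasFDerivAt.comp_hasDerivAt a (h1 a))).const_mul 2)
    have := add_mul_add_sq_le_of_le_deriv2 h2 h3 hσ0 (c := c) (fun b hb ↦ by
      have := (hnear b (v 0) hb hv_near).2
      simp only [Function.comp_apply]
      linarith) ha
    simpa using this
  have htrap : ∀ t, |s t| ≤ σ → y t ^ 2 + c * s t ^ 2 < min (c * σ ^ 2) (ε ^ 2) := by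
    intro t ht
    have h1 := hlower (s t) ht
    rw [← hvs t] at h1
    have h2 := henergy t
    have h3 : -(2 * ⟪v 0, B (v 0)⟫_ℝ * s t) ≤ 2 * |⟪v 0, B (v 0)⟫_ℝ| * σ := by
      refine (neg_le_abs _).trans ?_
      rw [abs_mul, abs_mul, abs_two]
      gcongr
    linarith
  have hsσ : ∀ t, |s t| ≤ σ := by
    by_contra! hne
    obtain ⟨t, ht⟩ := hne
    have hscont : Continuous fun t ↦ |s t| :=
      (continuous_iff_continuousAt.2 fun t ↦ (hsd t).continuousAt).abs
    obtain ⟨t', -, ht'⟩ := intermediate_value_uIcc (a := 0) (b := t) hscont.continuousOn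
      (Set.mem_uIcc.2 (Or.inl ⟨by simpa [hs0] using hσ0.le, ht.le⟩))
    have h1 := (htrap t' ht'.le).trans_le (min_le_left _ _)
    rw [← sq_abs (s t'), show |s t'| = σ from ht'] at h1
    nlinarith [sq_nonneg (y t')]
  intro t
  refine ⟨?_, ?_⟩
  · refine abs_lt_of_sq_lt_sq ?_ hε.le
    have := (htrap t (hsσ t)).trans_le (min_le_right _ _)
    have : 0 ≤ c * s t ^ 2 := by positivity
    linarith
  · rw [hvs t]
    exact (hnear _ _ (hsσ t) hv_near).1

end LinearFlow

section TracelessMaps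

variable {g : Type*} [NormedAddCommGroup g] [InnerProductSpace ℝ g] [FiniteDimensional ℝ g]

/-- For a traceless map `T` that is not skew-symmetric there is a vector `v` such that
`s ↦ ‖exp (s T) v‖²` has a nondegenerate local minimum at `0`. -/
theorem exists_inner_eq_zero_and_pos_of_trace_eq_zero {T : g →ₗ[ℝ] g}
    (htr : LinearMap.trace ℝ g T = 0) (hT : ∃ v, ⟪v, T v⟫_ℝ ≠ 0) :
    ∃ v, ⟪v, T v⟫_ℝ = 0 ∧ 0 < ⟪T v, T v⟫_ℝ + ⟪v, T (T v)⟫_ℝ := by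
  set S := T + LinearMap.adjoint T with hSdef
  have hS : S.IsSymmetric := by
    intro x y
    simp only [hSdef, LinearMap.add_apply, inner_add_left, inner_add_right,
      LinearMap.adjoint_inner_left, LinearMap.adjoint_inner_right]
    ring
  have hF : ∀ v, ⟪T v, T v⟫_ℝ + ⟪v, T (T v)⟫_ℝ = ⟪T v, S v⟫_ℝ := by
    intro v
    simp only [hSdef, LinearMap.add_apply, inner_add_right, LinearMap.adjoint_inner_right]
    rw [real_inner_comm v]
  have hSv : ∀ v w, ⟪v, S w⟫_ℝ = ⟪v, T w⟫_ℝ + ⟪w, T v⟫_ℝ := by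
    intro v w
    simp only [hSdef, LinearMap.add_apply, inner_add_right, LinearMap.adjoint_inner_right]
    rw [real_inner_comm w]
  let b := hS.eigenvectorBasis rfl
  let μ := hS.eigenvalues rfl
  have hb : ∀ i, S (b i) = μ i • b i := fun i ↦ hS.apply_eigenvectorBasis rfl i
  have hbb : ∀ i, ⟪b i, b i⟫_ℝ = 1 := fun i ↦ by simp
  have hq : ∀ i, ⟪b i, T (b i)⟫_ℝ = μ i / 2 := by
    intro i
    have := hSv (b i) (b i)
    rw [hb, inner_smul_right, hbb] at this
    linarith
  have hFb : ∀ i, ⟪T (b i), S (b i)⟫_ℝ = μ i ^ 2 / 2 := by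
    intro i
    rw [hb, inner_smul_right, real_inner_comm, hq]
    ring
  have hμ : ∃ i, μ i ≠ 0 := by
    by_contra! h0
    obtain ⟨v, hv⟩ := hT
    have hS0 : S = 0 := b.toBasis.ext fun i ↦ by simp [hb, h0]
    have := hSv v v
    rw [hS0, LinearMap.zero_apply, inner_zero_right] at this
    exact hv (by linarith)
  have hsum : ∀ s : Finset (Fin (Module.finrank ℝ g)), ∃ v, (∀ i ∉ s, ⟪v, b i⟫_ℝ = 0) ∧
      ⟪v, T v⟫_ℝ = ∑ i ∈ s, ⟪b i, T (b i)⟫_ℝ ∧ ∑ i ∈ s, ⟪T (b i), S (b i)⟫_ℝ ≤ ⟪T v, S v⟫_ℝ := by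
    intro s
    induction s using Finset.induction_on with
    | empty => exact ⟨0, by simp⟩
    | insert i s hi ih =>
      obtain ⟨v, hv, hvq, hvF⟩ := ih
      have hcross : ⟪v, T (b i)⟫_ℝ + ⟪b i, T v⟫_ℝ = 0 := by
        rw [← hSv, hb, inner_smul_right, hv i hi, mul_zero]
      obtain ⟨ε, hε, hε'⟩ : ∃ ε : ℝ, ε ^ 2 = 1 ∧ 0 ≤ ε * (⟪T v, S (b i)⟫_ℝ + ⟪T (b i), S v⟫_ℝ) := by
        rcases le_total 0 (⟪T v, S (b i)⟫_ℝ + ⟪T (b i), S v⟫_ℝ) with h | h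
        · exact ⟨1, by norm_num, by linarith⟩
        · exact ⟨-1, by norm_num, by linarith⟩
      refine ⟨v + ε • b i, fun j hj ↦ ?_, ?_, ?_⟩
      · rw [Finset.mem_insert, not_or] at hj
        rw [inner_add_left, hv j hj.2, real_inner_smul_left,
          b.inner_eq_zero (Ne.symm hj.1), mul_zero, add_zero]
      · rw [Finset.sum_insert hi, ← hvq]
        simp only [map_add, map_smul, inner_add_left, inner_add_right, inner_smul_right,
          real_inner_smul_left]
        linear_combination ε * hcross + ⟪b i, T (b i)⟫_ℝ * hε
      · rw [Finset.sum_insert hi]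
        have hexp : ⟪T (v + ε • b i), S (v + ε • b i)⟫_ℝ = ⟪T v, S v⟫_ℝ +
            ε * (⟪T v, S (b i)⟫_ℝ + ⟪T (b i), S v⟫_ℝ) + ⟪T (b i), S (b i)⟫_ℝ := by
          simp only [map_add, map_smul, inner_add_left, inner_add_right, inner_smul_right,
            real_inner_smul_left]
          linear_combination ⟪T (b i), S (b i)⟫_ℝ * hε
        rw [hexp]
        linarith
  obtain ⟨v, -, hvq, hvF⟩ := hsum Finset.univ
  refine ⟨v, ?_, ?_⟩
  · rw [hvq, ← LinearMap.trace_eq_sum_inner T b, htr]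
  · rw [hF]
    refine lt_of_lt_of_le ?_ hvF
    obtain ⟨i, hi⟩ := hμ
    simp only [hFb]
    exact Finset.sum_pos' (fun j _ ↦ by positivity) ⟨i, Finset.mem_univ i, by positivity⟩

end TracelessMaps

namespace LieStructure

variable {g : Type*} [NormedAddCommGroup g] [InnerProductSpace ℝ g] [FiniteDimensional ℝ g]

/-- A metric Lie algebra with an abelian subalgebra of codimension one either has nontrivial
centre or is a semidirect product of the line spanned by a unit vector `e` and the abelian ideal
orthogonal to `e`. -/
theorem exists_central_or_exists_bracket_eq {L : LieStructure g} {n : Submodule ℝ g}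
    (hn : Module.finrank ℝ n + 1 = Module.finrank ℝ g) (hn2 : 2 ≤ Module.finrank ℝ n)
    (hab : ∀ x ∈ n, ∀ y ∈ n, L.bracket x y = 0) :
    (∃ z ≠ 0, ∀ W, L.bracket z W = 0) ∨
      ∃ e : g, ‖e‖ = 1 ∧ (∀ W, ⟪e, L.bracket e W⟫_ℝ = 0) ∧
        ∀ Z W, L.bracket Z W = ⟪e, Z⟫_ℝ • L.bracket e W - ⟪e, W⟫_ℝ • L.bracket e Z := by
  have hperp : Module.finrank ℝ nᗮ = 1 := n.finrank_add_finrank_orthogonal' hn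
  have : Nontrivial nᗮ := Module.nontrivial_of_finrank_pos (R := ℝ) (by omega)
  obtain ⟨e', he'⟩ := exists_norm_eq (E := nᗮ) zero_le_one
  set e : g := e'.1
  have he : ‖e‖ = 1 := he'
  have hee : ⟪e, e⟫_ℝ = 1 := by rw [real_inner_self_eq_norm_sq, he, one_pow]
  have hen : ∀ w ∈ n, ⟪e, w⟫_ℝ = 0 := fun w hw ↦ Submodule.inner_left_of_mem_orthogonal hw e'.2
  have hproj : ∀ W, W - ⟪e, W⟫_ℝ • e ∈ n := by
    intro W
    rw [← n.orthogonal_orthogonal, Submodule.mem_orthogonal]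
    intro u hu
    obtain ⟨c, hc⟩ := (finrank_eq_one_iff_of_nonzero' e' (by
      rintro rfl
      simp at he')).1 hperp ⟨u, hu⟩
    have hc : c • e = u := congrArg Subtype.val hc
    rw [← hc, inner_sub_right, inner_smul_right, real_inner_smul_left, real_inner_smul_left, hee]
    ring
  have hbr : ∀ Z W, L.bracket Z W = ⟪e, Z⟫_ℝ • L.bracket e W - ⟪e, W⟫_ℝ • L.bracket e Z := by
    intro Z W
    have h := hab _ (hproj Z) _ (hproj W)
    simp only [map_sub, map_smul, LinearMap.sub_apply, LinearMap.smul_apply, L.bracket_self,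
      L.bracket_antisymm Z e, smul_zero, sub_zero, smul_neg, sub_neg_eq_add] at h
    rw [← sub_eq_zero, ← h]
    abel
  by_cases hideal : ∀ W, ⟪e, L.bracket e W⟫_ℝ = 0
  · exact Or.inr ⟨e, he, hideal, hbr⟩
  left
  push Not at hideal
  obtain ⟨w₁, hw₁⟩ := hideal
  let φ : n →ₗ[ℝ] ℝ := ((innerₗ g e).comp (L.bracket e)).comp n.subtype
  have hker : LinearMap.ker φ ≠ ⊥ := LinearMap.ker_ne_bot_of_finrank_lt (by
    rw [Module.finrank_self]; omega)
  obtain ⟨w₂, hw₂, hne⟩ := Submodule.exists_mem_ne_zero_of_ne_bot hker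
  have hw₂φ : ⟪e, L.bracket e w₂⟫_ℝ = 0 := hw₂
  have hew₂ : ⟪e, (w₂ : g)⟫_ℝ = 0 := hen _ w₂.2
  have h2 : L.bracket e w₂ = 0 := by
    set u := w₁ - ⟪e, w₁⟫_ℝ • e with hu
    have hun : u ∈ n := hproj w₁
    have heu : L.bracket e u = L.bracket e w₁ := by simp [hu, L.bracket_self]
    have hj := L.jacobi e u w₂
    rw [hab u hun w₂ w₂.2, L.bracket_antisymm w₂ e, map_neg, hbr u (L.bracket e w₂),
      hen u hun, hw₂φ, hbr w₂ (L.bracket e u), hew₂, heu] at hj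
    simpa [hw₁] using hj
  refine ⟨w₂, by simpa using hne, fun W ↦ ?_⟩
  rw [hbr, hew₂, h2, zero_smul, smul_zero, sub_zero]

/-- A unimodular semidirect product of a line with an orthogonal abelian ideal has a nonzero
stable stationary point. -/
theorem IsUnimodular.exists_stable_of_bracket_eq {L : LieStructure g} (hL : L.IsUnimodular)
    {e : g} (he : ‖e‖ = 1) (hideal : ∀ W, ⟪e, L.bracket e W⟫_ℝ = 0)
    (hbr : ∀ Z W, L.bracket Z W = ⟪e, Z⟫_ℝ • L.bracket e W - ⟪e, W⟫_ℝ • L.bracket e Z) :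
    ∃ X : g, X ≠ 0 ∧ L.IsStationary X ∧ L.IsStable X := by
  by_cases hskew : ∀ v, ⟪v, L.bracket e v⟫_ℝ = 0
  · exact ⟨e, fun h ↦ by simp [h] at he, isStationary_and_isStable_of_inner_bracket_eq_zero hskew⟩
  have hee : ⟪e, e⟫_ℝ = 1 := by rw [real_inner_self_eq_norm_sq, he, one_pow]
  set T := L.adT e with hTdef
  have hTl : ∀ v w, ⟪T v, w⟫_ℝ = ⟪v, L.bracket e w⟫_ℝ := L.inner_adT_left e
  have hTr : ∀ v w, ⟪v, T w⟫_ℝ = ⟪w, L.bracket e v⟫_ℝ := fun v w ↦ by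
    rw [real_inner_comm, hTl]
  have hTe : T e = 0 := ext_inner_right ℝ fun w ↦ by rw [hTl, hideal, inner_zero_left]
  have heT : ∀ w, ⟪e, T w⟫_ℝ = 0 := fun w ↦ by rw [hTr, L.bracket_self, inner_zero_right]
  obtain ⟨v, hv, hvF⟩ := exists_inner_eq_zero_and_pos_of_trace_eq_zero (T := T)
    (by rw [hTdef, trace_adT, hL e]) (by
      push Not at hskew
      obtain ⟨v, hv⟩ := hskew
      exact ⟨v, by rwa [hTr]⟩)
  have hTproj : ∀ w c, T (w - c • e) = T w := fun w c ↦ by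
    rw [map_sub, map_smul, hTe, smul_zero, sub_zero]
  have hiproj : ∀ w c u, ⟪w - c • e, T u⟫_ℝ = ⟪w, T u⟫_ℝ := fun w c u ↦ by
    rw [inner_sub_left, real_inner_smul_left, heT, mul_zero, sub_zero]
  set x := v - ⟪e, v⟫_ℝ • e with hx
  have hex : ⟪e, x⟫_ℝ = 0 := by rw [hx, inner_sub_right, inner_smul_right, hee]; ring
  have hxq : ⟪x, T x⟫_ℝ = 0 := by rw [hx, hTproj, hiproj, hv]
  have hxF : 0 < ⟪T x, T x⟫_ℝ + ⟪x, T (T x)⟫_ℝ := by rwa [hx, hTproj, hiproj]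
  have heuler : ∀ Y, L.adT Y Y = ⟪e, Y⟫_ℝ • T Y - ⟪Y, T Y⟫_ℝ • e := by
    refine fun Y ↦ ext_inner_right ℝ fun Z ↦ ?_
    rw [inner_adT_left, hbr, inner_sub_right, inner_smul_right, inner_smul_right, inner_sub_left,
      real_inner_smul_left, real_inner_smul_left, hTl, hTr]
    ring
  refine ⟨x, ?_, ?_, ?_⟩
  · intro h0
    simp [h0] at hxF
  · rw [IsStationary, heuler, hex, hxq, zero_smul, zero_smul, sub_zero]
  · intro ε hε
    obtain ⟨δ, hδ, hstab⟩ := exists_stability_radius (B := LinearMap.toContinuousLinearMap T)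
      hxq hxF (half_pos hε)
    refine ⟨δ / 2, half_pos hδ, fun Y hY hY0 t _ ↦ ?_⟩
    have hy0 : |⟪e, Y 0⟫_ℝ| ≤ ‖Y 0 - x‖ := by
      have := abs_real_inner_le_norm e (Y 0 - x)
      rwa [inner_sub_right, hex, sub_zero, he, one_mul] at this
    have hsplit : ∀ t, Y t - x = (Y t - ⟪e, Y t⟫_ℝ • e - x) + ⟪e, Y t⟫_ℝ • e := fun t ↦ by abel
    have hnorm : ∀ t, ‖⟪e, Y t⟫_ℝ • e‖ = |⟪e, Y t⟫_ℝ| := fun t ↦ by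
      rw [norm_smul, he, mul_one, Real.norm_eq_abs]
    have hyd : ∀ t, HasDerivAt (fun t ↦ ⟪e, Y t⟫_ℝ) (-⟪Y t, T (Y t)⟫_ℝ) t := fun t ↦
      ((hasDerivAt_const t e).inner ℝ (hY t)).congr_deriv (by
        rw [heuler, inner_sub_right, inner_smul_right, inner_smul_right, heT, hee, inner_zero_left]
        ring)
    have hvd : ∀ t, HasDerivAt (fun t ↦ Y t - ⟪e, Y t⟫_ℝ • e) (⟪e, Y t⟫_ℝ • T (Y t)) t := fun t ↦
      ((hY t).sub ((hyd t).smul_const e)).congr_deriv (by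
        rw [heuler, neg_smul]
        abel)
    have := hstab (fun t ↦ ⟪e, Y t⟫_ℝ) (fun t ↦ Y t - ⟪e, Y t⟫_ℝ • e)
      (fun t ↦ by simpa [hTproj] using hvd t) (fun t ↦ by simpa [hTproj, hiproj] using hyd t)
      (by linarith) (by
        have h : Y 0 - ⟪e, Y 0⟫_ℝ • e - x = (Y 0 - x) - ⟪e, Y 0⟫_ℝ • e := by abel
        have := norm_sub_le (Y 0 - x) (⟪e, Y 0⟫_ℝ • e)
        rw [hnorm] at this
        rw [h]
        linarith) t
    rw [hsplit t]
    refine (norm_add_le _ _).trans_lt ?_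
    rw [hnorm]
    linarith [this.1, this.2]

end LieStructure

/-- A 4-dimensional unimodular metric Lie algebra always has a nonzero stable
stationary point. -/
theorem exists_stable_stationary_dim4    {g : Type*} [NormedAddCommGroup g] [InnerProductSpace ℝ g] [FiniteDimensional ℝ g]
    (L : LieStructure g) (hdim : Module.finrank ℝ g = 4)
    (huni : L.IsUnimodular) :
    ∃ X : g, X ≠ 0 ∧ L.IsStationary X ∧ L.IsStable X := by
  rcases huni.exists_central_or_exists_abelian hdim with ⟨z, hz, hc⟩ | ⟨n, hn, hab⟩
  · exact ⟨z, hz, LieStructure.isStationary_and_isStable_of_inner_bracket_eq_zero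
      fun Y ↦ by rw [hc, inner_zero_right]⟩
  rcases LieStructure.exists_central_or_exists_bracket_eq (by omega) (by omega) hab with
    ⟨z, hz, hc⟩ | ⟨e, he, hideal, hbr⟩
  · exact ⟨z, hz, LieStructure.isStationary_and_isStable_of_inner_bracket_eq_zero
      fun Y ↦ by rw [hc, inner_zero_right]⟩
  · exact huni.exists_stable_of_bracket_eq he hideal hbr
end
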